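/- Assume (H1)–(H6) and let m₀ ∈ 𝓟(Ω̄). Then there exists an equilibrium Q ∈ 𝓟(Γ) of the mean field game with initial condition m₀: a measure Q with (e₀)_#Q = m₀, ∫_Γ F(γ,Q) dQ(γ) < +∞, and such that for Q-almost every γ ∈ Γ, F(γ,Q) = inf{F(ω,Q) : ω ∈ Γ, ω(0) = γ(0)}, where F(γ,Q) = ∫₀^∞ ℓ(t,γ(t),γ̇(t)) dt + Ψ(τ(γ)) + ∫_Γ ∫₀^{τ(γ)∧τ(γ̃)} h(t,γ(t),γ̃(t),γ̇(t),γ̃̇(t)) dt dQ(γ̃) (with F = +∞ if γ is not absolutely continuous, if Q gives positive measure to non-absolutely-continuous curves, or if the inner integral is not Q-integrable). -/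

import Mathlib

open MeasureTheory Filter Topology Set
open scoped ENNReal NNReal

noncomputable section

/-- Euclidean space `ℝ^d`. -/
abbrev EucSp (d : ℕ) := EuclideanSpace ℝ (Fin d)

/-- The space `Γ = C(ℝ₊, Ω̄)` of continuous curves with values in `closure Ω`, endowed with
the topology of uniform convergence on compact time intervals (the compact-open topology). -/
abbrev CurveSp {d : ℕ} (Ω : Set (EucSp d)) :=
  {γ : C(ℝ≥0, EucSp d) // ∀ t : ℝ≥0, γ t ∈ closure Ω}

variable {d : ℕ}

/-- `γ` is absolutely continuous with (locally integrable) velocity `g`. -/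
def HasVel {Ω : Set (EucSp d)} (γ : CurveSp Ω) (g : ℝ → EucSp d) : Prop :=
  (∀ T : ℝ, IntegrableOn g (Set.Icc 0 T) volume) ∧
    ∀ t : ℝ≥0, γ.1 t = γ.1 0 + ∫ s in Set.Ioc (0 : ℝ) (t : ℝ), g s

/-- The first exit time `τ(γ) = inf {t ≥ 0 | γ(t) ∈ Ξ}`, with value `+∞` if `γ` never
reaches `Ξ`. -/
def exitT {Ω : Set (EucSp d)} (Ξ : Set (EucSp d)) (γ : CurveSp Ω) : ℝ≥0∞ :=
  ⨅ (t : ℝ≥0) (_ : γ.1 t ∈ Ξ), (t : ℝ≥0∞)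

/-- The extension of a nondecreasing `Ψ : ℝ₊ → ℝ₊` to `[0,+∞]`: for finite `T` it coincides
with `Ψ(T)` (as `Ψ` is nondecreasing), and `Ψ(+∞) = sup Ψ`. -/
def PsiExt (Ψ : ℝ → ℝ) (T : ℝ≥0∞) : ℝ≥0∞ :=
  ⨆ (t : ℝ≥0) (_ : (t : ℝ≥0∞) ≤ T), ENNReal.ofReal (Ψ (t : ℝ))

/-- The individual cost `L(γ) = ∫₀^∞ ℓ(t,γ(t),γ̇(t)) dt + Ψ(τ(γ))` if `γ` is absolutely
continuous, and `L(γ) = +∞` otherwise (the infimum over an empty family is `+∞`; any two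
velocities of `γ` agree a.e., so the infimum is the common value of the integral). -/
def Lcost {Ω : Set (EucSp d)} (ℓ : ℝ → EucSp d → EucSp d → ℝ) (Ψ : ℝ → ℝ)
    (Ξ : Set (EucSp d)) (γ : CurveSp Ω) : ℝ≥0∞ :=
  (⨅ (g : ℝ → EucSp d) (_ : HasVel γ g),
    ∫⁻ t in Set.Ioi (0 : ℝ), ENNReal.ofReal (ℓ t (γ.1 t.toNNReal) (g t))) +
  PsiExt Ψ (exitT Ξ γ)

/-- The raw pairwise interaction cost
`∫₀^{τ(γ) ∧ τ(γ̃)} h(t,γ(t),γ̃(t),γ̇(t),γ̃̇(t)) dt`, equal to `+∞` when one of the curves is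
not absolutely continuous. -/
def interCost {Ω : Set (EucSp d)}
    (h : ℝ → EucSp d → EucSp d → EucSp d → EucSp d → ℝ)
    (Ξ : Set (EucSp d)) (γ γ' : CurveSp Ω) : ℝ≥0∞ :=
  ⨅ (g : ℝ → EucSp d) (_ : HasVel γ g) (g' : ℝ → EucSp d) (_ : HasVel γ' g'),
    ∫⁻ t in {t : ℝ | 0 < t ∧ ENNReal.ofReal t < min (exitT Ξ γ) (exitT Ξ γ')},
      ENNReal.ofReal (h t (γ.1 t.toNNReal) (γ'.1 t.toNNReal) (g t) (g' t))

/-- The interaction cost `H(γ,γ̃)`, equal to the raw interaction cost when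
`L(γ) < +∞` and `L(γ̃) < +∞`, and to `+∞` otherwise. -/
def Hcost {Ω : Set (EucSp d)} (ℓ : ℝ → EucSp d → EucSp d → ℝ) (Ψ : ℝ → ℝ)
    (h : ℝ → EucSp d → EucSp d → EucSp d → EucSp d → ℝ)
    (Ξ : Set (EucSp d)) (γ γ' : CurveSp Ω) : ℝ≥0∞ :=
  if Lcost ℓ Ψ Ξ γ ≠ ⊤ ∧ Lcost ℓ Ψ Ξ γ' ≠ ⊤ then interCost h Ξ γ γ' else ⊤

instance {Ω : Set (EucSp d)} : MeasurableSpace (CurveSp Ω) := borel _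
instance {Ω : Set (EucSp d)} : BorelSpace (CurveSp Ω) := ⟨rfl⟩

/-- The total cost `F(γ,Q)` from the mean field game, with the conventions of the paper:
`F(γ,Q) = +∞` if `γ` is not absolutely continuous, if `Q` gives positive measure to
non-absolutely-continuous curves, or if the inner interaction integral is not `Q`-integrable. -/
def F1cost {Ω : Set (EucSp d)} (ℓ : ℝ → EucSp d → EucSp d → ℝ) (Ψ : ℝ → ℝ)
    (h : ℝ → EucSp d → EucSp d → EucSp d → EucSp d → ℝ)
    (Ξ : Set (EucSp d)) (γ : CurveSp Ω) (Q : Measure (CurveSp Ω)) : ℝ≥0∞ :=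
  if Q {γ' : CurveSp Ω | ¬ ∃ g : ℝ → EucSp d, HasVel γ' g} = 0 then
    Lcost ℓ Ψ Ξ γ + ∫⁻ γ', interCost h Ξ γ γ' ∂Q
  else ⊤

/-- The total cost `F(γ,Q) = L(γ) + ∫ H(γ,·) dQ` of the associated abstract non-atomic game. -/
def F2cost {Ω : Set (EucSp d)} (ℓ : ℝ → EucSp d → EucSp d → ℝ) (Ψ : ℝ → ℝ)
    (h : ℝ → EucSp d → EucSp d → EucSp d → EucSp d → ℝ)
    (Ξ : Set (EucSp d)) (γ : CurveSp Ω) (Q : Measure (CurveSp Ω)) : ℝ≥0∞ :=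
  Lcost ℓ Ψ Ξ γ + ∫⁻ γ', Hcost ℓ Ψ h Ξ γ γ' ∂Q

/-- The geodesic (intrinsic) distance in `S`: the infimum of the lengths (total variations)
of continuous paths in `S` joining `x` to `y`. -/
def geoDist {d : ℕ} (S : Set (EucSp d)) (x y : EucSp d) : ℝ≥0∞ :=
  ⨅ (f : ℝ → EucSp d) (_ : ContinuousOn f (Set.Icc 0 1))
    (_ : ∀ t ∈ Set.Icc (0 : ℝ) 1, f t ∈ S) (_ : f 0 = x) (_ : f 1 = y),
    eVariationOn f (Set.Icc 0 1)

section Semicontinuity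

/-- Fatou's lemma as lower semicontinuity of a parametric integral. -/
theorem LowerSemicontinuous.lintegral_of_aemeasurable {X Z : Type*} [TopologicalSpace X]
    [FirstCountableTopology X] [MeasurableSpace Z] {μ : Measure Z} {g : X → Z → ℝ≥0∞}
    (hg : ∀ z, LowerSemicontinuous fun x => g x z) (hm : ∀ x, AEMeasurable (g x) μ) :
    LowerSemicontinuous fun x => ∫⁻ z, g x z ∂μ := by
  rw [lowerSemicontinuous_iff_le_liminf]
  intro x
  exact (lintegral_mono fun z => lowerSemicontinuous_iff_le_liminf.1 (hg z) x).trans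
    (lintegral_liminf_le' hm)

theorem lowerSemicontinuous_of_isCompact_sublevel {X : Type*} [TopologicalSpace X] [T2Space X]
    {f : X → ℝ≥0∞}
    (hf : ∀ c : ℝ≥0, IsCompact {x | f x ≤ c}) : LowerSemicontinuous f := by
  rw [lowerSemicontinuous_iff_isClosed_preimage]
  intro c
  induction c with
  | top => simp
  | coe c => exact (hf c).isClosed

variable {X : Type*} [TopologicalSpace X] [TopologicalSpace.MetrizableSpace X]
  [SecondCountableTopology X] [MeasurableSpace X] [BorelSpace X]

theorem lowerSemicontinuous_lintegral_min_const {f : X → ℝ≥0∞} (hf : LowerSemicontinuous f)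
    (n : ℕ) :
    LowerSemicontinuous fun Q : ProbabilityMeasure X => ∫⁻ x, min (f x) n ∂(Q : Measure X) := by
  have hmeas : Measurable fun x => (min (f x) n).toReal :=
    (hf.measurable.min measurable_const).ennreal_toReal
  have hfin : ∀ x, min (f x) n ≠ ⊤ := fun x =>
    ne_top_of_le_ne_top (ENNReal.natCast_ne_top n) (min_le_right _ _)
  have key : ∀ Q : ProbabilityMeasure X, ∫⁻ x, min (f x) n ∂(Q : Measure X) =
      ∫⁻ t in Ioi (0 : ℝ), (Q : Measure X) {x | t < (min (f x) n).toReal} := fun Q => by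
    rw [← lintegral_eq_lintegral_meas_lt (Q : Measure X)
      (Eventually.of_forall fun x => ENNReal.toReal_nonneg) hmeas.aemeasurable]
    exact lintegral_congr fun x => (ENNReal.ofReal_toReal (hfin x)).symm
  have hanti : ∀ Q : ProbabilityMeasure X,
      Antitone fun t : ℝ => (Q : Measure X) {x | t < (min (f x) n).toReal} :=
    fun Q s t hst => measure_mono fun x hx => lt_of_le_of_lt hst hx
  simp_rw [key]
  rw [lowerSemicontinuous_iff_le_liminf]
  intro Q
  refine le_trans (setLIntegral_mono' measurableSet_Ioi fun t ht => ?_)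
    (lintegral_liminf_le' (u := 𝓝 Q) fun Q' => (hanti Q').measurable.aemeasurable)
  apply ProbabilityMeasure.le_liminf_measure_open_of_tendsto tendsto_id
  have : {x | t < (min (f x) n).toReal} = {x | ENNReal.ofReal t < min (f x) n} := by
    ext x
    exact (ENNReal.ofReal_lt_iff_lt_toReal (le_of_lt ht) (hfin x)).symm
  rw [this]
  exact (hf.inf lowerSemicontinuous_const).isOpen_preimage _

/-- The integral of a nonnegative lower semicontinuous function is a lower semicontinuous
function of the probability measure. -/
theorem LowerSemicontinuous.lintegral_probabilityMeasure {f : X → ℝ≥0∞}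
    (hf : LowerSemicontinuous f) :
    LowerSemicontinuous fun Q : ProbabilityMeasure X => ∫⁻ x, f x ∂(Q : Measure X) := by
  have key : ∀ Q : ProbabilityMeasure X, ∫⁻ x, f x ∂(Q : Measure X) =
      ⨆ n : ℕ, ∫⁻ x, min (f x) n ∂(Q : Measure X) := fun Q => by
    rw [← lintegral_iSup (fun n => hf.measurable.min measurable_const)]
    · refine lintegral_congr fun x => ?_
      rw [← inf_iSup_eq, ENNReal.iSup_natCast, inf_top_eq]
    · intro m n hmn x
      exact min_le_min le_rfl (by exact_mod_cast hmn)
  simp_rw [key]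
  exact lowerSemicontinuous_iSup fun n => lowerSemicontinuous_lintegral_min_const hf n

/-- Moment bounds on a function with compact sublevel sets give compact sets of measures. -/
theorem isCompact_setOf_lintegral_le {f : X → ℝ≥0∞} (hf : ∀ c : ℝ≥0, IsCompact {x | f x ≤ c})
    (c : ℝ≥0) : IsCompact {Q : ProbabilityMeasure X | ∫⁻ x, f x ∂(Q : Measure X) ≤ c} := by
  have hlsc := lowerSemicontinuous_of_isCompact_sublevel hf
  have hcl : IsClosed {Q : ProbabilityMeasure X | ∫⁻ x, f x ∂(Q : Measure X) ≤ c} :=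
    hlsc.lintegral_probabilityMeasure.isClosed_preimage _
  rw [← hcl.closure_eq]
  apply isCompact_closure_of_isTightMeasureSet
  rw [isTightMeasureSet_iff_exists_isCompact_measure_compl_le]
  intro ε hε
  obtain ⟨δ, hδ0, hδ⟩ := ENNReal.lt_iff_exists_nnreal_btwn.1 hε
  have hδ0' : δ ≠ 0 := by rintro rfl; simp at hδ0
  have hR : (0 : ℝ≥0) < c / δ + 1 := by positivity
  refine ⟨{x | f x ≤ (c / δ + 1 : ℝ≥0)}, hf _, ?_⟩
  rintro _ ⟨Q, hQ, rfl⟩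
  refine le_trans ?_ hδ.le
  have h1 := mul_meas_ge_le_lintegral (μ := (Q : Measure X)) hlsc.measurable
    ((c / δ + 1 : ℝ≥0) : ℝ≥0∞)
  have h2 : (Q : Measure X) {x | f x ≤ (c / δ + 1 : ℝ≥0)}ᶜ ≤
      (Q : Measure X) {x | ((c / δ + 1 : ℝ≥0) : ℝ≥0∞) ≤ f x} :=
    measure_mono fun x hx => (not_le.1 (show ¬ f x ≤ _ from hx)).le
  have h3 : ((c / δ + 1 : ℝ≥0) : ℝ≥0∞) *
      (Q : Measure X) {x | f x ≤ (c / δ + 1 : ℝ≥0)}ᶜ ≤ c :=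
    (mul_le_mul_right h2 _).trans (h1.trans hQ)
  have h4 : (c : ℝ≥0∞) ≤ ((c / δ + 1 : ℝ≥0) : ℝ≥0∞) * δ := by
    norm_cast
    rw [add_mul, div_mul_cancel₀ _ hδ0']
    simp
  exact (ENNReal.mul_le_mul_iff_right (by exact_mod_cast hR.ne') ENNReal.coe_ne_top).1
    (h3.trans h4)

end Semicontinuity

theorem LowerSemicontinuous.le_of_tendsto {X ι : Type*} [TopologicalSpace X] {f : X → ℝ≥0∞}
    (hf : LowerSemicontinuous f) {l : Filter ι} [l.NeBot] {u : ι → X} {x : X} {c : ℝ≥0∞}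
    (hu : Tendsto u l (𝓝 x)) (hc : Tendsto (fun i => f (u i)) l (𝓝 c)) : f x ≤ c := by
  refine le_of_forall_lt fun y hy => ?_
  obtain ⟨z, hyz, hz⟩ := exists_between hy
  exact hyz.trans_le (ge_of_tendsto hc ((hu.eventually (hf x z hz)).mono fun i hi => hi.le))

section Lift

variable {X : Type*} [TopologicalSpace X] [TopologicalSpace.MetrizableSpace X]
  [SecondCountableTopology X] [MeasurableSpace X] [BorelSpace X]
  {Y : Type*} [MetricSpace Y] [SecondCountableTopology Y] [MeasurableSpace Y] [BorelSpace Y]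

/-- A measure on the base lifts to a measure concentrated on fiberwise minimizers of `f`, in the
integrated sense. This replaces a measurable selection argument. -/
theorem exists_probabilityMeasure_map_eq_lintegral_le {e : X → Y} (he : Continuous e)
    (m : ProbabilityMeasure Y) {f : X → ℝ≥0∞} (hf : ∀ c : ℝ≥0, IsCompact {x | f x ≤ c})
    {M : ℝ≥0} (hM : ∀ y, ∃ x, e x = y ∧ f x ≤ M) :
    ∃ Q : ProbabilityMeasure X, (Q : Measure X).map e = m ∧
      ∫⁻ x, f x ∂(Q : Measure X) ≤ ∫⁻ y, ⨅ (x : X) (_ : e x = y), f x ∂(m : Measure Y) := by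
  have hlsc := lowerSemicontinuous_of_isCompact_sublevel hf
  have hmin : ∀ y, ∃ w, e w = y ∧ f w ≤ M ∧ ∀ x, e x = y → f w ≤ f x := by
    intro y
    obtain ⟨x, hxy, hxM⟩ := hM y
    have hcpt : IsCompact ({x | f x ≤ M} ∩ e ⁻¹' {y}) :=
      (hf M).inter_right (isClosed_singleton.preimage he)
    obtain ⟨w, ⟨hwM, hwy⟩, hw⟩ := (hlsc.lowerSemicontinuousOn _).exists_isMinOn
      (show ({x | f x ≤ M} ∩ e ⁻¹' {y}).Nonempty from ⟨x, hxM, hxy⟩) hcpt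
    refine ⟨w, hwy, hwM, fun x' hx' => ?_⟩
    by_cases h : f x' ≤ M
    · exact hw ⟨h, hx'⟩
    · exact le_trans hwM (not_le.1 h).le
  choose w hwe hwM hwmin using hmin
  have hV : ∀ y, ⨅ (x : X) (_ : e x = y), f x = f (w y) := fun y =>
    le_antisymm (iInf₂_le (w y) (hwe y)) (le_iInf₂ fun x hx => hwmin y x hx)
  simp_rw [hV]
  have hVmeas : Measurable fun y => f (w y) := by
    refine measurable_of_Iic fun c => ?_
    induction c with
    | top => simp
    | coe c =>
      have : (fun y => f (w y)) ⁻¹' Iic (c : ℝ≥0∞) = e '' {x | f x ≤ c} := by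
        ext y
        refine ⟨fun hy => ⟨w y, hy, hwe y⟩, ?_⟩
        rintro ⟨x, hx, rfl⟩
        exact (hwmin _ x rfl).trans hx
      rw [this]
      exact ((hf c).image he).isClosed.measurableSet
  set v : Y → ℝ := fun y => (f (w y)).toReal with hv
  have hvof : ∀ y, ENNReal.ofReal (v y) = f (w y) := fun y =>
    ENNReal.ofReal_toReal (ne_top_of_le_ne_top ENNReal.coe_ne_top (hwM y))
  have hgraph : Measurable fun y => (y, v y) := measurable_id.prodMk hVmeas.ennreal_toReal
  have : Nonempty Y := by
    by_contra hne
    rw [not_nonempty_iff] at hne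
    have h1 := measure_univ (μ := (m : Measure Y))
    rw [Set.eq_empty_of_isEmpty (univ : Set Y), measure_empty] at h1
    exact zero_ne_one h1
  obtain ⟨y₀⟩ := this
  set s : Set (Y × ℝ) := range fun y => (y, v y) with hs
  have hy₀ : (y₀, v y₀) ∈ s := ⟨y₀, rfl⟩
  let u : ℕ → SimpleFunc Y (Y × ℝ) := SimpleFunc.approxOn (fun y => (y, v y)) hgraph s _ hy₀
  have hu_mem : ∀ n y, (u n y).2 = v (u n y).1 := fun n y => by
    obtain ⟨z, hz⟩ := SimpleFunc.approxOn_mem hgraph hy₀ n y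
    change (z, v z) = u n y at hz
    rw [← hz]
  have hu_lim : ∀ y, Tendsto (fun n => u n y) atTop (𝓝 (y, v y)) := fun y =>
    SimpleFunc.tendsto_approxOn hgraph hy₀ (subset_closure ⟨y, rfl⟩)
  have hwm : ∀ n, Measurable fun y => w (u n y).1 := fun n =>
    (SimpleFunc.map (fun p : Y × ℝ => w p.1) (u n)).measurable
  let Q : ℕ → ProbabilityMeasure X := fun n => m.map (hwm n).aemeasurable
  have hQint : ∀ n, ∫⁻ x, f x ∂(Q n : Measure X) = ∫⁻ y, ENNReal.ofReal (u n y).2 ∂(m : Measure Y) := by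
    intro n
    rw [show ((Q n : Measure X)) = (m : Measure Y).map fun y => w (u n y).1 from rfl,
      lintegral_map hlsc.measurable (hwm n)]
    exact lintegral_congr fun y => by rw [hu_mem, hvof]
  have hlim : Tendsto (fun n => ∫⁻ x, f x ∂(Q n : Measure X)) atTop
      (𝓝 (∫⁻ y, f (w y) ∂(m : Measure Y))) := by
    simp_rw [hQint]
    refine tendsto_lintegral_of_dominated_convergence (fun _ => (M : ℝ≥0∞))
      (fun n => (u n).measurable.snd.ennreal_ofReal) (fun n => ?_) (by simp) ?_
    · exact Eventually.of_forall fun y => by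
        change ENNReal.ofReal (u n y).2 ≤ M
        rw [hu_mem, hvof]; exact hwM _
    · refine Eventually.of_forall fun y => ?_
      rw [← hvof]
      exact ENNReal.tendsto_ofReal ((continuous_snd.tendsto _).comp (hu_lim y))
  have hmem : ∀ n, Q n ∈ {Q : ProbabilityMeasure X | ∫⁻ x, f x ∂(Q : Measure X) ≤ M} := by
    intro n
    change ∫⁻ x, f x ∂(Q n : Measure X) ≤ M
    rw [hQint]
    refine (lintegral_mono (g := fun _ => (M : ℝ≥0∞)) fun y => ?_).trans (by simp)
    change ENNReal.ofReal (u n y).2 ≤ M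
    rw [hu_mem, hvof]; exact hwM _
  obtain ⟨R, -, φ, hφ, hR⟩ := (isCompact_setOf_lintegral_le hf M).tendsto_subseq hmem
  refine ⟨R, ?_, ?_⟩
  · have h1 : Tendsto (fun n => (Q (φ n)).map he.measurable.aemeasurable) atTop
        (𝓝 (R.map he.measurable.aemeasurable)) :=
      ((ProbabilityMeasure.continuous_map he).tendsto R).comp hR
    have h2 : Tendsto (fun n => (Q n).map he.measurable.aemeasurable) atTop (𝓝 m) := by
      rw [ProbabilityMeasure.tendsto_iff_forall_integral_tendsto]
      intro g
      have h3 : ∀ n, ∫ y, g y ∂((Q n).map he.measurable.aemeasurable : Measure Y) =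
          ∫ y, g (u n y).1 ∂(m : Measure Y) := fun n => by
        rw [show ((Q n).map he.measurable.aemeasurable : Measure Y) =
            ((m : Measure Y).map fun y => w (u n y).1).map e from rfl,
          Measure.map_map he.measurable (hwm n), integral_map
          (he.measurable.comp (hwm n)).aemeasurable g.continuous.aestronglyMeasurable]
        exact integral_congr_ae (Eventually.of_forall fun y => by simp [hwe])
      simp_rw [h3]
      refine tendsto_integral_of_dominated_convergence (fun _ => ‖g‖)
        (fun n => (g.continuous.measurable.comp (u n).measurable.fst).aestronglyMeasurable)
        (integrable_const _) (fun n => Eventually.of_forall fun y => g.norm_coe_le_norm _) ?_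
      exact Eventually.of_forall fun y =>
        (g.continuous.tendsto _).comp ((continuous_fst.tendsto _).comp (hu_lim y))
    have h4 := tendsto_nhds_unique h1 (h2.comp hφ.tendsto_atTop)
    exact congrArg (fun P : ProbabilityMeasure Y => (P : Measure Y)) h4
  · exact hlsc.lintegral_probabilityMeasure.le_of_tendsto hR (hlim.comp hφ.tendsto_atTop)

end Lift

section Equilibrium

theorem LowerSemicontinuous.tsub_const {Z : Type*} [TopologicalSpace Z] {f : Z → ℝ≥0∞}
    (hf : LowerSemicontinuous f) (c : ℝ≥0∞) : LowerSemicontinuous fun x => f x - c := by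
  intro x y hy
  filter_upwards [hf x (y + c) (lt_tsub_iff_right.1 hy)] with z hz
  exact lt_tsub_iff_right.2 hz

theorem lintegral_lintegral_convexCombination {X : Type*} [MeasurableSpace X]
    {μ ν : Measure X} [SFinite μ] [SFinite ν]
    {I : X → X → ℝ≥0∞} (hI : Measurable (Function.uncurry I)) (hsymm : ∀ x x', I x x' = I x' x)
    (δ ε : ℝ≥0∞) :
    ∫⁻ x, ∫⁻ x', I x x' ∂(δ • μ + ε • ν) ∂(δ • μ + ε • ν) =
      δ * δ * ∫⁻ x, ∫⁻ x', I x x' ∂μ ∂μ + 2 * (δ * ε) * ∫⁻ x, ∫⁻ x', I x x' ∂μ ∂ν +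
        ε * ε * ∫⁻ x, ∫⁻ x', I x x' ∂ν ∂ν := by
  have hm1 : Measurable fun x => ∫⁻ x', I x x' ∂μ := hI.lintegral_prod_right'
  have hm2 : Measurable fun x => ∫⁻ x', I x x' ∂ν := hI.lintegral_prod_right'
  have hswap : ∫⁻ x, ∫⁻ x', I x x' ∂ν ∂μ = ∫⁻ x, ∫⁻ x', I x x' ∂μ ∂ν := by
    rw [lintegral_lintegral_swap hI.aemeasurable]
    simp_rw [hsymm]
  simp only [lintegral_add_measure, lintegral_smul_measure, smul_eq_mul]
  rw [lintegral_add_left (hm1.const_mul _), lintegral_const_mul _ hm1, lintegral_const_mul _ hm2,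
    lintegral_add_left (hm1.const_mul _), lintegral_const_mul _ hm1, lintegral_const_mul _ hm2,
    hswap]
  ring

/-- First-order optimality condition for a quadratic functional on probability measures. -/
theorem lintegral_add_lintegral_le_of_isMin {X : Type*} [MeasurableSpace X]
    {μ ν : Measure X} [IsProbabilityMeasure μ]
    [IsProbabilityMeasure ν] {L : X → ℝ≥0∞} {I : X → X → ℝ≥0∞}
    (hI : Measurable (Function.uncurry I)) (hsymm : ∀ x x', I x x' = I x' x)
    (hLμ : ∫⁻ x, L x ∂μ ≠ ⊤) (hLν : ∫⁻ x, L x ∂ν ≠ ⊤)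
    (hμμ : ∫⁻ x, ∫⁻ x', I x x' ∂μ ∂μ ≠ ⊤) (hμν : ∫⁻ x, ∫⁻ x', I x x' ∂μ ∂ν ≠ ⊤)
    (hνν : ∫⁻ x, ∫⁻ x', I x x' ∂ν ∂ν ≠ ⊤)
    (hmin : ∀ δ ε : ℝ≥0, δ + ε = 1 →
      2 * ∫⁻ x, L x ∂μ + ∫⁻ x, ∫⁻ x', I x x' ∂μ ∂μ ≤
        2 * ∫⁻ x, L x ∂((δ : ℝ≥0∞) • μ + (ε : ℝ≥0∞) • ν) +
          ∫⁻ x, ∫⁻ x', I x x' ∂((δ : ℝ≥0∞) • μ + (ε : ℝ≥0∞) • ν)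
            ∂((δ : ℝ≥0∞) • μ + (ε : ℝ≥0∞) • ν)) :
    ∫⁻ x, L x ∂μ + ∫⁻ x, ∫⁻ x', I x x' ∂μ ∂μ ≤
      ∫⁻ x, L x ∂ν + ∫⁻ x, ∫⁻ x', I x x' ∂μ ∂ν := by
  simp only [lintegral_lintegral_convexCombination hI hsymm] at hmin
  simp only [lintegral_add_measure, lintegral_smul_measure, smul_eq_mul] at hmin
  lift ∫⁻ x, L x ∂μ to ℝ≥0 using hLμ with p
  lift ∫⁻ x, L x ∂ν to ℝ≥0 using hLν with q
  lift ∫⁻ x, ∫⁻ x', I x x' ∂μ ∂μ to ℝ≥0 using hμμ with r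
  lift ∫⁻ x, ∫⁻ x', I x x' ∂μ ∂ν to ℝ≥0 using hμν with s
  lift ∫⁻ x, ∫⁻ x', I x x' ∂ν ∂ν to ℝ≥0 using hνν with t
  norm_cast at hmin ⊢
  have h1 : ∀ ε : ℝ, 0 < ε → ε ≤ 1 → (p : ℝ) + r ≤ q + s + ε * (r + t) := by
    intro ε h0 h1
    have h2 := hmin ⟨1 - ε, by linarith⟩ ⟨ε, h0.le⟩ (NNReal.eq (sub_add_cancel 1 ε))
    have h3 : (2 : ℝ) * p + r ≤ 2 * ((1 - ε) * p + ε * q) +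
      ((1 - ε) * (1 - ε) * r + 2 * ((1 - ε) * ε) * s + ε * ε * t) := by exact_mod_cast h2
    have hr : (0 : ℝ) ≤ r := r.2
    have ht : (0 : ℝ) ≤ t := t.2
    have hs : (0 : ℝ) ≤ s := s.2
    have h4 : 0 ≤ ε * (2 * (q + s + ε * (r + t)) - 2 * (p + r)) := by
      nlinarith [mul_nonneg (mul_nonneg h0.le h0.le) hr, mul_nonneg (mul_nonneg h0.le h0.le) ht,
        mul_nonneg (mul_nonneg h0.le h0.le) hs]
    nlinarith [nonneg_of_mul_nonneg_right h4 h0]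
  have h2 : Tendsto (fun ε : ℝ => (q : ℝ) + s + ε * (r + t)) (𝓝[>] 0) (𝓝 (q + s + 0 * (r + t))) :=
    tendsto_nhdsWithin_of_tendsto_nhds (by
      apply Continuous.tendsto (f := fun ε : ℝ => (q : ℝ) + s + ε * (r + t)); fun_prop)
  rw [zero_mul, add_zero] at h2
  have h3 : (p : ℝ) + r ≤ q + s := ge_of_tendsto h2 (by
    filter_upwards [Ioc_mem_nhdsGT (zero_lt_one' ℝ)] with ε hε using h1 ε hε.1 hε.2)
  exact_mod_cast h3

variable {X : Type*} [TopologicalSpace X] [TopologicalSpace.MetrizableSpace X]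
  [SecondCountableTopology X] [MeasurableSpace X] [BorelSpace X]
  {Y : Type*} [MetricSpace Y] [SecondCountableTopology Y] [MeasurableSpace Y] [BorelSpace Y]

/-- Existence of equilibria for potential (symmetric) non-atomic games. -/
theorem exists_symmetric_game_equilibrium {e : X → Y} (he : Continuous e)
    (m : ProbabilityMeasure Y) {L : X → ℝ≥0∞} (hL : ∀ c : ℝ≥0, IsCompact {x | L x ≤ c})
    {I : X → X → ℝ≥0∞} (hI : Measurable (Function.uncurry I)) (hsymm : ∀ x x', I x x' = I x' x)
    (hG : LowerSemicontinuous fun p : X × X => L p.1 + L p.2 + I p.1 p.2)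
    {A B : ℝ≥0} (hIb : ∀ x x', I x x' ≤ A + B * (L x + L x'))
    {κ : ℝ≥0} (hκ : ∀ y, ∃ x, e x = y ∧ L x ≤ κ) :
    ∃ Q : ProbabilityMeasure X, (Q : Measure X).map e = m ∧
      ∫⁻ x, L x ∂(Q : Measure X) ≠ ⊤ ∧
      ∫⁻ x, (L x + ∫⁻ x', I x x' ∂(Q : Measure X)) ∂(Q : Measure X) ≠ ⊤ ∧
      ∀ᵐ x ∂(Q : Measure X), L x + ∫⁻ x', I x x' ∂(Q : Measure X) =
        ⨅ (w : X) (_ : e w = e x), (L w + ∫⁻ x', I w x' ∂(Q : Measure X)) := by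
  have hLlsc := lowerSemicontinuous_of_isCompact_sublevel hL
  have hLm := hLlsc.measurable
  have hIm : ∀ x, Measurable (I x) := fun x => hI.comp measurable_prodMk_left
  have hbint : ∀ (x : X) (R : ProbabilityMeasure X), ∫⁻ x', I x x' ∂(R : Measure X) ≤
      A + B * (L x + ∫⁻ x', L x' ∂(R : Measure X)) := by
    intro x R
    refine (lintegral_mono (hIb x)).trans_eq ?_
    rw [lintegral_add_left measurable_const, lintegral_const_mul _ (hLm.const_add _),
      lintegral_add_left measurable_const]
    simp
  have hbb : ∀ P R : ProbabilityMeasure X,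
      ∫⁻ x, ∫⁻ x', I x x' ∂(R : Measure X) ∂(P : Measure X) ≤
      A + B * (∫⁻ x', L x' ∂(P : Measure X) + ∫⁻ x', L x' ∂(R : Measure X)) := by
    intro P R
    refine (lintegral_mono fun x => hbint x R).trans_eq ?_
    rw [lintegral_add_left measurable_const, lintegral_const_mul _ (hLm.add_const _),
      lintegral_add_right _ measurable_const]
    simp
  have hbfin : ∀ P R : ProbabilityMeasure X, ∫⁻ x', L x' ∂(P : Measure X) ≠ ⊤ →
      ∫⁻ x', L x' ∂(R : Measure X) ≠ ⊤ →
      ∫⁻ x, ∫⁻ x', I x x' ∂(R : Measure X) ∂(P : Measure X) ≠ ⊤ := fun P R hP hR =>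
    ne_top_of_le_ne_top (by finiteness) (hbb P R)
  set J : ProbabilityMeasure X → ℝ≥0∞ := fun P =>
    2 * ∫⁻ x, L x ∂(P : Measure X) + ∫⁻ x, ∫⁻ x', I x x' ∂(P : Measure X) ∂(P : Measure X) with hJ
  have hJlsc : LowerSemicontinuous J := by
    have h1 : LowerSemicontinuous fun P : ProbabilityMeasure X =>
        ∫⁻ p, (L p.1 + L p.2 + I p.1 p.2) ∂((P.prod P : ProbabilityMeasure (X × X)) :
          Measure (X × X)) :=
      hG.lintegral_probabilityMeasure.comp
        (ProbabilityMeasure.continuous_prod.comp (continuous_id.prodMk continuous_id))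
    convert h1 using 2 with P
    rw [ProbabilityMeasure.toMeasure_prod, lintegral_prod _ hG.measurable.aemeasurable]
    have h2 : ∀ x, ∫⁻ x', (L x + L x' + I x x') ∂(P : Measure X) =
        L x + ∫⁻ x', L x' ∂(P : Measure X) + ∫⁻ x', I x x' ∂(P : Measure X) := fun x => by
      rw [lintegral_add_right _ (hIm x), lintegral_add_left measurable_const]; simp
    simp only [h2, hJ]
    rw [lintegral_add_left (hLm.add_const _), lintegral_add_right _ measurable_const]
    simp [two_mul]
  have hLJ : ∀ P : ProbabilityMeasure X, ∫⁻ x, L x ∂(P : Measure X) ≤ J P := fun P => by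
    simp only [hJ, two_mul, add_assoc]; exact le_self_add
  obtain ⟨Q₀, hQ₀e, hQ₀L⟩ := exists_probabilityMeasure_map_eq_lintegral_le he m hL hκ
  have hQ₀fin : ∫⁻ x, L x ∂(Q₀ : Measure X) ≠ ⊤ := by
    refine ne_top_of_le_ne_top (b := (κ : ℝ≥0∞)) ENNReal.coe_ne_top (hQ₀L.trans ?_)
    refine (lintegral_mono (g := fun _ => (κ : ℝ≥0∞)) fun y => ?_).trans (by simp)
    obtain ⟨x, hx, hxκ⟩ := hκ y
    exact (iInf₂_le x hx).trans hxκ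
  have hJ₀ : J Q₀ ≠ ⊤ := by
    have := hbfin Q₀ Q₀ hQ₀fin hQ₀fin
    simp only [hJ]; finiteness
  obtain ⟨M, hM⟩ : ∃ M : ℝ≥0, (M : ℝ≥0∞) = J Q₀ := ⟨_, ENNReal.coe_toNNReal hJ₀⟩
  have hK : IsCompact ({P : ProbabilityMeasure X | ∫⁻ x, L x ∂(P : Measure X) ≤ M} ∩
      {P | P.map he.measurable.aemeasurable = m}) :=
    (isCompact_setOf_lintegral_le hL M).inter_right
      (isClosed_singleton.preimage (ProbabilityMeasure.continuous_map he))
  have hcoe : ∀ P : ProbabilityMeasure X, P.map he.measurable.aemeasurable = m ↔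
      (P : Measure X).map e = m := fun P =>
    ⟨fun h => congrArg (fun R : ProbabilityMeasure Y => (R : Measure Y)) h, fun h => Subtype.ext h⟩
  obtain ⟨Q, ⟨hQM, hQe⟩, hQmin⟩ := (hJlsc.lowerSemicontinuousOn _).exists_isMinOn
    (show (_ ∩ _ : Set (ProbabilityMeasure X)).Nonempty from
      ⟨Q₀, (hLJ Q₀).trans hM.ge, (hcoe Q₀).2 hQ₀e⟩) hK
  have hQe' := (hcoe Q).1 hQe
  have hQfin : ∫⁻ x, L x ∂(Q : Measure X) ≠ ⊤ := ne_top_of_le_ne_top ENNReal.coe_ne_top hQM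
  have hglob : ∀ P : ProbabilityMeasure X, (P : Measure X).map e = m → J Q ≤ J P := by
    intro P hP
    by_cases hPM : ∫⁻ x, L x ∂(P : Measure X) ≤ M
    · exact hQmin ⟨hPM, (hcoe P).2 hP⟩
    · have h1 : J Q ≤ J Q₀ := hQmin ⟨(hLJ Q₀).trans hM.ge, (hcoe Q₀).2 hQ₀e⟩
      exact (h1.trans hM.ge).trans ((not_le.1 hPM).le.trans (hLJ P))
  set F : X → ℝ≥0∞ := fun x => L x + ∫⁻ x', I x x' ∂(Q : Measure X) with hF
  have hFlsc : LowerSemicontinuous F := by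
    have h1 : LowerSemicontinuous fun x => ∫⁻ x', (L x + L x' + I x x') ∂(Q : Measure X) :=
      LowerSemicontinuous.lintegral_of_aemeasurable
        (fun z => hG.comp (Continuous.prodMk_left z))
        (fun x => ((hLm.const_add _).add (hIm x)).aemeasurable)
    convert h1.tsub_const (∫⁻ x, L x ∂(Q : Measure X)) using 2 with x
    rw [lintegral_add_right _ (hIm x), lintegral_add_left measurable_const]
    simp only [lintegral_const, measure_univ, mul_one, hF]
    rw [add_right_comm, ENNReal.add_sub_cancel_right hQfin]
  have hFc : ∀ c : ℝ≥0, IsCompact {x | F x ≤ c} := fun c =>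
    (hL c).of_isClosed_subset (hFlsc.isClosed_preimage _) fun x hx =>
      show L x ≤ c from le_self_add.trans hx
  obtain ⟨M', hM'⟩ : ∃ M' : ℝ≥0, (M' : ℝ≥0∞) =
      κ + (A + B * (κ + ∫⁻ x, L x ∂(Q : Measure X))) :=
    ⟨_, ENNReal.coe_toNNReal (by finiteness)⟩
  have hFM : ∀ y, ∃ x, e x = y ∧ F x ≤ M' := by
    intro y
    obtain ⟨x, hx, hxκ⟩ := hκ y
    refine ⟨x, hx, ?_⟩
    rw [hM']
    refine add_le_add hxκ ((hbint x Q).trans ?_)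
    gcongr
  obtain ⟨R, hRe, hRF⟩ := exists_probabilityMeasure_map_eq_lintegral_le he m hFc hFM
  have hVfin : ∫⁻ y, ⨅ (x : X) (_ : e x = y), F x ∂(m : Measure Y) ≠ ⊤ := by
    refine ne_top_of_le_ne_top (b := (M' : ℝ≥0∞)) ENNReal.coe_ne_top ?_
    refine (lintegral_mono (g := fun _ => (M' : ℝ≥0∞)) fun y => ?_).trans (by simp)
    obtain ⟨x, hx, hxM⟩ := hFM y
    exact (iInf₂_le x hx).trans hxM
  have hRfin : ∫⁻ x, L x ∂(R : Measure X) ≠ ⊤ :=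
    ne_top_of_le_ne_top hVfin ((lintegral_mono fun x => le_self_add).trans hRF)
  have hFint : ∀ P : ProbabilityMeasure X, ∫⁻ x, F x ∂(P : Measure X) =
      ∫⁻ x, L x ∂(P : Measure X) + ∫⁻ x, ∫⁻ x', I x x' ∂(Q : Measure X) ∂(P : Measure X) :=
    fun P => lintegral_add_left hLm _
  have hQR : ∫⁻ x, F x ∂(Q : Measure X) ≤ ∫⁻ x, F x ∂(R : Measure X) := by
    rw [hFint, hFint]
    refine lintegral_add_lintegral_le_of_isMin hI hsymm hQfin hRfin (hbfin _ _ hQfin hQfin)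
      (hbfin _ _ hRfin hQfin) (hbfin _ _ hRfin hRfin) fun δ ε hδε => ?_
    have hδε' : (δ : ℝ≥0∞) + ε = 1 := by exact_mod_cast hδε
    have hprob : IsProbabilityMeasure
        ((δ : ℝ≥0∞) • (Q : Measure X) + (ε : ℝ≥0∞) • (R : Measure X)) := ⟨by simpa using hδε'⟩
    refine hglob ⟨_, hprob⟩ ?_
    change Measure.map e ((δ : ℝ≥0∞) • (Q : Measure X) + (ε : ℝ≥0∞) • (R : Measure X)) = m
    rw [Measure.map_add _ _ he.measurable, Measure.map_smul, Measure.map_smul, hQe', hRe,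
      ← add_smul, hδε', one_smul]
  have hFV : ∫⁻ x, F x ∂(Q : Measure X) ≤
      ∫⁻ x, ⨅ (w : X) (_ : e w = e x), F w ∂(Q : Measure X) := by
    refine (hQR.trans hRF).trans ?_
    rw [← hQe']
    exact lintegral_map_le _ _
  have hFfin : ∫⁻ x, F x ∂(Q : Measure X) ≠ ⊤ := ne_top_of_le_ne_top hVfin (hQR.trans hRF)
  have hVF : ∀ x, ⨅ (w : X) (_ : e w = e x), F w ≤ F x := fun x =>
    iInf₂_le (f := fun (w : X) (_ : e w = e x) => F w) x rfl
  refine ⟨Q, hQe', hQfin, hFfin, ?_⟩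
  have := ae_eq_of_ae_le_of_lintegral_le (Eventually.of_forall hVF)
    (ne_top_of_le_ne_top hFfin (lintegral_mono hVF)) hFlsc.measurable.aemeasurable hFV
  exact this.mono fun x hx => hx.symm

end Equilibrium

section Komlos

variable {W : Type*} [NormedAddCommGroup W] [InnerProductSpace ℝ W]

theorem norm_sub_sq_le_midpoint_defect (p q : W) :
    ‖p - q‖ ^ 2 ≤ ((√(1 + ‖p‖ ^ 2) + √(1 + ‖q‖ ^ 2)) / 2 -
      √(1 + ‖(2⁻¹ : ℝ) • (p + q)‖ ^ 2)) * (√(1 + ‖p‖ ^ 2) + √(1 + ‖q‖ ^ 2)) ^ 3 := by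
  have hd : ‖p - q‖ ^ 2 = ‖p‖ ^ 2 + ‖q‖ ^ 2 - 2 * inner ℝ p q := by
    rw [norm_sub_sq_real]; ring
  have hs : ‖(2⁻¹ : ℝ) • (p + q)‖ ^ 2 = (‖p‖ ^ 2 + ‖q‖ ^ 2 + 2 * inner ℝ p q) / 4 := by
    rw [norm_smul, mul_pow, norm_add_sq_real]; norm_num; ring
  have hc := abs_le.1 (abs_real_inner_le_norm p q)
  rw [hd, hs]
  have hP := norm_nonneg p
  have hQ := norm_nonneg q
  generalize inner ℝ p q = c at *
  generalize ‖p‖ = P at *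
  generalize ‖q‖ = Q at *
  have hc2 : c ^ 2 ≤ (P * Q) ^ 2 := sq_le_sq' hc.1 hc.2
  have hx := Real.sq_sqrt (show 0 ≤ 1 + P ^ 2 by positivity)
  have hy := Real.sq_sqrt (show 0 ≤ 1 + Q ^ 2 by positivity)
  have hz := Real.sq_sqrt (show 0 ≤ 1 + (P ^ 2 + Q ^ 2 + 2 * c) / 4 by nlinarith [sq_nonneg (P - Q)])
  have hx0 : 0 < √(1 + P ^ 2) := Real.sqrt_pos.2 (by positivity)
  have hy0 : 0 < √(1 + Q ^ 2) := Real.sqrt_pos.2 (by positivity)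
  have hz0 := Real.sqrt_nonneg (1 + (P ^ 2 + Q ^ 2 + 2 * c) / 4)
  generalize √(1 + P ^ 2) = x at *
  generalize √(1 + Q ^ 2) = y at *
  generalize √(1 + (P ^ 2 + Q ^ 2 + 2 * c) / 4) = z at *
  have hxy : 1 + P * Q ≤ x * y := by
    refine abs_le_of_sq_le_sq' ?_ (by positivity) |>.2
    rw [mul_pow, hx, hy]; nlinarith [sq_nonneg (P - Q)]
  have hzS : 2 * z ≤ x + y := by
    refine abs_le_of_sq_le_sq' ?_ (by positivity) |>.2
    nlinarith
  set S := x + y with hS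
  have hS0 : 0 < S := by positivity
  set d := P ^ 2 + Q ^ 2 - 2 * c with hdd
  have hd0 : 0 ≤ d := by nlinarith [sq_nonneg (P - Q)]
  have h1 : (x - y) ^ 2 * S ^ 2 ≤ d * (S ^ 2 - 4) := by
    have h2 : (x - y) ^ 2 * S ^ 2 = (P ^ 2 - Q ^ 2) ^ 2 := by
      rw [← mul_pow, show (x - y) * S = x ^ 2 - y ^ 2 by rw [hS]; ring, hx, hy]; ring
    have h3 : (P ^ 2 - Q ^ 2) ^ 2 ≤ d * (P ^ 2 + Q ^ 2 + 2 * c) := by nlinarith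
    have h4 : P ^ 2 + Q ^ 2 + 2 * c ≤ S ^ 2 - 4 := by nlinarith
    rw [h2]
    exact h3.trans (mul_le_mul_of_nonneg_left h4 hd0)
  have h5 : d = (S - 2 * z) * (S + 2 * z) + (x - y) ^ 2 := by
    have : (S - 2 * z) * (S + 2 * z) + (x - y) ^ 2 = 2 * x ^ 2 + 2 * y ^ 2 - 4 * z ^ 2 := by
      rw [hS]; ring
    rw [this, hx, hy, hz, hdd]; ring
  have h6 : (S - 2 * z) * (S + 2 * z) ≤ (S - 2 * z) * (2 * S) :=
    mul_le_mul_of_nonneg_left (by linarith) (by linarith)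
  have h7 : d * S ^ 2 ≤ (S - 2 * z) * (2 * S) * S ^ 2 + d * (S ^ 2 - 4) := by
    calc d * S ^ 2 = (S - 2 * z) * (S + 2 * z) * S ^ 2 + (x - y) ^ 2 * S ^ 2 := by
          nth_rewrite 1 [h5]; ring
      _ ≤ _ := add_le_add (mul_le_mul_of_nonneg_right h6 (by positivity)) h1
  nlinarith

theorem sqrt_norm_sub_le (p q : W) (n : ℕ) :
    √‖p - q‖ ≤ 8 ^ n * ((√(1 + ‖p‖ ^ 2) + √(1 + ‖q‖ ^ 2)) / 2 -
      √(1 + ‖(2⁻¹ : ℝ) • (p + q)‖ ^ 2)) +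
      (2⁻¹) ^ n * (√(1 + ‖p‖ ^ 2) + √(1 + ‖q‖ ^ 2)) := by
  have h := norm_sub_sq_le_midpoint_defect p q
  have hS0 : 0 < √(1 + ‖p‖ ^ 2) + √(1 + ‖q‖ ^ 2) := by positivity
  generalize (√(1 + ‖p‖ ^ 2) + √(1 + ‖q‖ ^ 2)) / 2 - √(1 + ‖(2⁻¹ : ℝ) • (p + q)‖ ^ 2) = D at *
  generalize √(1 + ‖p‖ ^ 2) + √(1 + ‖q‖ ^ 2) = S at *
  have hu := Real.sqrt_nonneg ‖p - q‖
  have hu2 := Real.sq_sqrt (norm_nonneg (p - q))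
  rw [← hu2] at h
  generalize √‖p - q‖ = u at *
  have hD : 0 ≤ D := by
    by_contra! hD
    have : D * S ^ 3 < 0 := mul_neg_of_neg_of_pos hD (by positivity)
    nlinarith [sq_nonneg (u ^ 2)]
  have h8 : (8 : ℝ) ^ n = (2 ^ n) ^ 3 := by rw [← pow_mul, mul_comm, pow_mul]; norm_num
  by_cases hc : u ≤ (2⁻¹) ^ n * S
  · have : 0 ≤ 8 ^ n * D := by positivity
    linarith
  · push Not at hc
    have hS : S ≤ 2 ^ n * u := by
      rw [inv_pow, inv_mul_lt_iff₀ (by positivity)] at hc; exact hc.le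
    have hu0 : 0 < u := lt_of_le_of_lt (by positivity) hc
    have h1 : u ^ 3 * u ≤ u ^ 3 * (8 ^ n * D) := by
      calc u ^ 3 * u = (u ^ 2) ^ 2 := by ring
        _ ≤ D * S ^ 3 := h
        _ ≤ D * (2 ^ n * u) ^ 3 := by gcongr
        _ = _ := by rw [h8]; ring
    have h2 := le_of_mul_le_mul_left h1 (by positivity)
    have : 0 ≤ (2⁻¹) ^ n * S := by positivity
    linarith

/-- A Komlós-type extraction: a decreasing sequence of convex sets, bounded in `L¹`, contains an
almost everywhere convergent selection. -/
theorem exists_mem_ae_tendsto_of_antitone_convex {T : Type*} [MeasurableSpace T] {ν : Measure T}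
    [IsFiniteMeasure ν] [CompleteSpace W] {E : Type*} [AddCommGroup E] [Module ℝ E]
    (Λ : E →ₗ[ℝ] (T → W)) {A : ℕ → Set E} (hanti : Antitone A) (hconv : ∀ n, Convex ℝ (A n))
    (hne : ∀ n, (A n).Nonempty) (hint : ∀ a ∈ A 0, Integrable (Λ a) ν) {M : ℝ}
    (hM : ∀ a ∈ A 0, ∫ t, ‖Λ a t‖ ∂ν ≤ M) :
    ∃ a : ℕ → E, (∀ n, a n ∈ A n) ∧
      ∀ᵐ t ∂ν, ∃ l, Tendsto (fun n => Λ (a n) t) atTop (𝓝 l) := by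
  set N : W → ℝ := fun p => √(1 + ‖p‖ ^ 2) with hN
  have hNle : ∀ p, N p ≤ 1 + ‖p‖ := fun p => by
    refine Real.sqrt_le_iff.2 ⟨by positivity, ?_⟩
    nlinarith [norm_nonneg p]
  have hN0 : ∀ p, 0 ≤ N p := fun p => Real.sqrt_nonneg _
  have hNcont : Continuous N := by fun_prop
  have hmem : ∀ {n a}, a ∈ A n → a ∈ A 0 := fun h => hanti (Nat.zero_le _) h
  have hNint : ∀ a ∈ A 0, Integrable (fun t => N (Λ a t)) ν := fun a ha =>
    ((integrable_const (1 : ℝ)).add (hint a ha).norm).mono'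
      (hNcont.comp_aestronglyMeasurable (hint a ha).1)
      (Eventually.of_forall fun t => by
        rw [Real.norm_of_nonneg (hN0 _)]; exact hNle _)
  set I : E → ℝ := fun a => ∫ t, N (Λ a t) ∂ν with hI
  set K : ℝ := ν.real univ + M with hK
  have hIK : ∀ a ∈ A 0, I a ≤ K := fun a ha => by
    calc I a ≤ ∫ t, (1 + ‖Λ a t‖) ∂ν :=
          integral_mono (hNint a ha) ((integrable_const _).add (hint a ha).norm) fun t => hNle _
      _ = ν.real univ + ∫ t, ‖Λ a t‖ ∂ν := by
          rw [integral_add (integrable_const _) (hint a ha).norm]; simp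
      _ ≤ K := by rw [hK]; gcongr; exact hM a ha
  have hI0 : ∀ a, 0 ≤ I a := fun a => integral_nonneg fun t => hN0 _
  set i : ℕ → ℝ := fun n => sInf (I '' A n) with hi
  have hbdd : ∀ n, BddBelow (I '' A n) := fun n => ⟨0, by rintro _ ⟨a, -, rfl⟩; exact hI0 a⟩
  have hile : ∀ {n a}, a ∈ A n → i n ≤ I a := fun {n a} ha => csInf_le (hbdd n) ⟨a, ha, rfl⟩
  have himono : Monotone i := fun m n hmn =>
    csInf_le_csInf (hbdd m) ((hne n).image I) (image_mono (hanti hmn))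
  have hibdd : BddAbove (range i) := ⟨K, by
    rintro _ ⟨n, rfl⟩
    obtain ⟨a, ha⟩ := hne n
    exact (hile ha).trans (hIK a (hmem ha))⟩
  set l := ⨆ n, i n with hl
  have hil : Tendsto i atTop (𝓝 l) := tendsto_atTop_ciSup himono hibdd
  obtain ⟨φ, hφ, hφl⟩ := extraction_forall_of_eventually
    (P := fun n k => l - (16⁻¹ : ℝ) ^ n < i k) fun n =>
      hil.eventually (lt_mem_nhds (sub_lt_self l (by positivity)))
  have hex : ∀ n, ∃ a ∈ A (φ n), I a < l + (16⁻¹ : ℝ) ^ n := fun n => by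
    obtain ⟨_, ⟨a, ha, rfl⟩, hlt⟩ := exists_lt_of_csInf_lt ((hne (φ n)).image I)
      (show i (φ n) < l + (16⁻¹ : ℝ) ^ n from
        lt_of_le_of_lt (le_ciSup hibdd _) (lt_add_of_pos_right _ (by positivity)))
    exact ⟨a, ha, hlt⟩
  choose a haA haI using hex
  have ha0 : ∀ n, a n ∈ A 0 := fun n => hmem (haA n)
  refine ⟨a, fun n => hanti (hφ.id_le n) (haA n), ?_⟩
  have hmid : ∀ n, (2⁻¹ : ℝ) • (a n + a (n + 1)) ∈ A (φ n) := fun n => by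
    rw [smul_add]
    exact hconv _ (haA n) (hanti (hφ.monotone n.le_succ) (haA (n + 1))) (by norm_num)
      (by norm_num) (by norm_num)
  set u : ℕ → T → ℝ := fun n t => √‖Λ (a n) t - Λ (a (n + 1)) t‖ with hu
  set v : ℕ → T → ℝ := fun n t =>
    8 ^ n * ((N (Λ (a n) t) + N (Λ (a (n + 1)) t)) / 2 -
      N (Λ ((2⁻¹ : ℝ) • (a n + a (n + 1))) t)) +
      (2⁻¹) ^ n * (N (Λ (a n) t) + N (Λ (a (n + 1)) t)) with hv
  have huv : ∀ n t, u n t ≤ v n t := fun n t => by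
    have := sqrt_norm_sub_le (Λ (a n) t) (Λ (a (n + 1)) t) n
    simpa only [hu, hv, hN, map_smul, map_add, Pi.smul_apply, Pi.add_apply] using this
  have hv1 : ∀ n, Integrable (fun t => (N (Λ (a n) t) + N (Λ (a (n + 1)) t))) ν := fun n =>
    (hNint _ (ha0 n)).add (hNint _ (ha0 (n + 1)))
  have hv2 : ∀ n, Integrable (fun t => (N (Λ (a n) t) + N (Λ (a (n + 1)) t)) / 2 -
      N (Λ ((2⁻¹ : ℝ) • (a n + a (n + 1))) t)) ν := fun n =>
    ((hv1 n).div_const 2).sub (hNint _ (hmem (hmid n)))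
  have hvint : ∀ n, Integrable (v n) ν := fun n =>
    ((hv2 n).const_mul _).add ((hv1 n).const_mul _)
  have hvle : ∀ n, ∫ t, v n t ∂ν ≤ (2 + 2 * K) * (2⁻¹) ^ n := fun n => by
    have h1 : ∫ t, v n t ∂ν = 8 ^ n * ((I (a n) + I (a (n + 1))) / 2 -
        I ((2⁻¹ : ℝ) • (a n + a (n + 1)))) + (2⁻¹) ^ n * (I (a n) + I (a (n + 1))) := by
      simp only [hv]
      rw [integral_add ((hv2 n).const_mul _) ((hv1 n).const_mul _), integral_const_mul,
        integral_const_mul, integral_sub ((hv1 n).div_const 2) (hNint _ (hmem (hmid n))),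
        integral_div, integral_add (hNint _ (ha0 n)) (hNint _ (ha0 (n + 1)))]
    have h2 : (I (a n) + I (a (n + 1))) / 2 - I ((2⁻¹ : ℝ) • (a n + a (n + 1))) ≤
        2 * (16⁻¹) ^ n := by
      have h3 := haI n
      have h4 := haI (n + 1)
      have h5 := (hφl n).trans_le (hile (hmid n))
      have h6 : (16⁻¹ : ℝ) ^ (n + 1) ≤ 16⁻¹ ^ n :=
        pow_le_pow_of_le_one (by norm_num) (by norm_num) n.le_succ
      linarith
    have h7 : (8 : ℝ) ^ n * (2 * 16⁻¹ ^ n) = 2 * 2⁻¹ ^ n := by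
      rw [mul_left_comm, ← mul_pow]; norm_num
    rw [h1]
    calc _ ≤ 8 ^ n * (2 * (16⁻¹) ^ n) + (2⁻¹) ^ n * (K + K) := by
          gcongr
          exacts [hIK _ (ha0 n), hIK _ (ha0 (n + 1))]
      _ = _ := by rw [h7]; ring
  have hu0 : ∀ n t, 0 ≤ u n t := fun n t => Real.sqrt_nonneg _
  have humeas : ∀ n, AEMeasurable (fun t => ENNReal.ofReal (u n t)) ν := fun n =>
    (Real.continuous_sqrt.comp_aestronglyMeasurable
      ((hint _ (ha0 n)).1.sub (hint _ (ha0 (n + 1))).1).norm).aemeasurable.ennreal_ofReal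
  have hK0 : 0 ≤ K := (hI0 _).trans (hIK _ (ha0 0))
  have hsum : ∫⁻ t, ∑' n, ENNReal.ofReal (u n t) ∂ν ≠ ⊤ := by
    rw [lintegral_tsum humeas]
    refine ne_top_of_le_ne_top ?_ (ENNReal.tsum_le_tsum
      (g := fun n => ENNReal.ofReal ((2 + 2 * K) * (2⁻¹) ^ n)) fun n => ?_)
    · exact ((summable_geometric_of_lt_one (by norm_num) (by norm_num)).mul_left _).tsum_ofReal_ne_top
    · calc ∫⁻ t, ENNReal.ofReal (u n t) ∂ν ≤ ∫⁻ t, ENNReal.ofReal (v n t) ∂ν :=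
            lintegral_mono fun t => ENNReal.ofReal_le_ofReal (huv n t)
        _ = ENNReal.ofReal (∫ t, v n t ∂ν) :=
            (ofReal_integral_eq_lintegral_ofReal (hvint n)
              (Eventually.of_forall fun t => (hu0 n t).trans (huv n t))).symm
        _ ≤ _ := ENNReal.ofReal_le_ofReal (hvle n)
  filter_upwards [ae_lt_top' (AEMeasurable.tsum humeas) hsum] with t ht
  have hus : Summable fun n => u n t := by
    have := ENNReal.summable_toReal ht.ne
    simpa only [ENNReal.toReal_ofReal (hu0 _ t)] using this
  have hds : Summable fun n => dist (Λ (a n) t) (Λ (a (n + 1)) t) := by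
    refine hus.of_norm_bounded_eventually_nat ?_
    filter_upwards [hus.tendsto_atTop_zero.eventually (gt_mem_nhds zero_lt_one)] with n hn
    rw [Real.norm_of_nonneg dist_nonneg, dist_eq_norm,
      ← Real.sq_sqrt (norm_nonneg (Λ (a n) t - Λ (a (n + 1)) t))]
    change u n t ^ 2 ≤ u n t
    nlinarith [hu0 n t]
  exact cauchySeq_tendsto_of_complete (cauchySeq_of_summable_dist hds)

end Komlos

section LowerClosure

theorem exists_forall_mul_le_rpow {θ : ℝ} (hθ : 1 < θ) (K : ℝ) :
    ∃ R : ℝ≥0, 1 ≤ R ∧ ∀ s : ℝ, R ≤ s → K * s ≤ s ^ θ := by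
  obtain ⟨R, hR⟩ := eventually_atTop.1
    ((tendsto_rpow_atTop (sub_pos.2 hθ)).eventually_ge_atTop K)
  refine ⟨(max R 1).toNNReal, by simp, fun s hs => ?_⟩
  rw [Real.coe_toNNReal _ (by positivity), max_le_iff] at hs
  have h0 : 0 < s := by linarith
  calc K * s ≤ s ^ (θ - 1) * s := by gcongr; exact hR s hs.1
    _ = s ^ θ := by rw [Real.rpow_sub_one h0.ne', div_mul_cancel₀ _ h0.ne']

theorem rpow_le_one_add_rpow {s β θ : ℝ} (hs : 0 ≤ s) (hβ : 0 ≤ β) (hβθ : β ≤ θ) :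
    s ^ β ≤ 1 + s ^ θ := by
  have := Real.rpow_nonneg hs θ
  rcases le_total s 1 with h | h
  · linarith [Real.rpow_le_one hs h hβ]
  · linarith [Real.rpow_le_rpow_of_exponent_le h hβθ]

/-- A superlinear function, convex in its second variable, has approximate subgradients which are
locally uniform in the first variable. -/
theorem exists_affine_le_eventually {X V : Type*} [TopologicalSpace X] [NormedAddCommGroup V]
    [NormedSpace ℝ V] [FiniteDimensional ℝ V] {φ : X → V → ℝ}
    (hφ : Continuous (Function.uncurry φ)) (hconv : ∀ x, ConvexOn ℝ univ (φ x))
    {α θ : ℝ} (hα : 0 < α) (hθ : 1 < θ) (hlb : ∀ x p, α * ‖p‖ ^ θ ≤ φ x p) (x : X) (p : V)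
    {r : ℝ} (hr : r < φ x p) :
    ∃ (ξ : V →L[ℝ] ℝ) (c : ℝ), r < ξ p + c ∧ ∀ᶠ y in 𝓝 x, ∀ q, ξ q + c ≤ φ y q := by
  obtain ⟨r', hrr', hr'⟩ := exists_between hr
  have hcx : Continuous (φ x) := hφ.comp (Continuous.prodMk_right x)
  obtain ⟨ξ, c, hle, heq⟩ := (hconv x).exists_affine_le_of_lt (𝕜 := ℝ) (mem_univ p) hr'
    isClosed_univ (hcx.lowerSemicontinuous.lowerSemicontinuousOn _)
  have hle' : ∀ q, ξ q + c ≤ φ x q := fun q => by simpa using hle ⟨q, mem_univ q⟩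
  have heq' : ξ p + c = r' := by simpa using heq
  obtain ⟨R, hR1, hR⟩ := exists_forall_mul_le_rpow hθ ((‖ξ‖ + |c|) / α)
  refine ⟨ξ, c - (r' - r) / 2, by linarith, ?_⟩
  have hK : ∀ᶠ y in 𝓝 x, ∀ q ∈ Metric.closedBall (0 : V) R, ξ q + (c - (r' - r) / 2) < φ y q := by
    refine (isCompact_closedBall (0 : V) R).eventually_forall_of_forall_eventually fun q _ => ?_
    have h1 : Continuous fun z : X × V => ξ z.2 + (c - (r' - r) / 2) := by fun_prop
    refine h1.continuousAt.eventually_lt hφ.continuousAt ?_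
    change ξ q + (c - (r' - r) / 2) < φ x q
    linarith [hle' q]
  filter_upwards [hK] with y hy q
  by_cases hq : ‖q‖ ≤ R
  · exact (hy q (by simpa using hq)).le
  · have h1 := hR ‖q‖ (not_le.1 hq).le
    have hq1 : 1 ≤ ‖q‖ := le_trans (by exact_mod_cast hR1) (not_le.1 hq).le
    have h2 : (‖ξ‖ + |c|) * ‖q‖ ≤ α * ‖q‖ ^ θ := by
      rw [div_mul_eq_mul_div, div_le_iff₀ hα] at h1; linarith
    have h3 : ξ q ≤ ‖ξ‖ * ‖q‖ := (le_abs_self _).trans (ξ.le_opNorm q)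
    have h4 : c ≤ |c| * ‖q‖ := (le_abs_self c).trans (le_mul_of_one_le_right (abs_nonneg c) hq1)
    linarith [hlb y q]

theorem lintegral_enorm_rpow_le_of_ae_tendsto {V : Type*} [NormedAddCommGroup V]
    {T : Type*} [MeasurableSpace T] {ν : Measure T} {θ : ℝ} {φ : ℕ → T → V} (hφ : ∀ n, AEStronglyMeasurable (φ n) ν) {M : ℝ≥0∞}
    (hb : ∀ n, ∫⁻ t, ‖φ n t‖ₑ ^ θ ∂ν ≤ M) {g : T → V}
    (hlim : ∀ᵐ t ∂ν, Tendsto (fun n => φ n t) atTop (𝓝 (g t))) :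
    ∫⁻ t, ‖g t‖ₑ ^ θ ∂ν ≤ M := by
  calc ∫⁻ t, ‖g t‖ₑ ^ θ ∂ν = ∫⁻ t, liminf (fun n => ‖φ n t‖ₑ ^ θ) atTop ∂ν := by
        refine lintegral_congr_ae ?_
        filter_upwards [hlim] with t ht
        exact (((ENNReal.continuous_rpow_const.tendsto _).comp ht.enorm).liminf_eq).symm
    _ ≤ liminf (fun n => ∫⁻ t, ‖φ n t‖ₑ ^ θ ∂ν) atTop :=
        lintegral_liminf_le' fun n => (hφ n).enorm.pow_const _
    _ ≤ M := liminf_le_of_le (by isBoundedDefault) fun b hb' => by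
        obtain ⟨n, hn⟩ := hb'.exists; exact hn.trans (hb n)

theorem integrable_of_lintegral_enorm_rpow {V : Type*} [NormedAddCommGroup V]
    {T : Type*} [MeasurableSpace T] {ν : Measure T}
    [IsFiniteMeasure ν] {θ : ℝ} (hθ : 1 < θ) {φ : T → V} (hφ : AEStronglyMeasurable φ ν)
    (hb : ∫⁻ t, ‖φ t‖ₑ ^ θ ∂ν ≠ ⊤) : Integrable φ ν := by
  have h : MemLp φ (ENNReal.ofReal θ) ν := by
    refine ⟨hφ, ?_⟩
    have h0 : ENNReal.ofReal θ ≠ 0 := by simp; linarith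
    rw [eLpNorm_lt_top_iff_lintegral_rpow_enorm_lt_top h0 ENNReal.ofReal_ne_top,
      ENNReal.toReal_ofReal (by linarith)]
    exact hb.lt_top
  exact h.integrable (by simpa using hθ.le)

theorem tendsto_integral_of_lintegral_enorm_rpow_le {V : Type*} [NormedAddCommGroup V]
    [NormedSpace ℝ V] {T : Type*} [MeasurableSpace T] {ν : Measure T}
    [IsFiniteMeasure ν] {θ : ℝ} (hθ : 1 < θ) {φ : ℕ → T → V}
    (hφ : ∀ n, AEStronglyMeasurable (φ n) ν) {M : ℝ≥0∞} (hM : M ≠ ⊤)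
    (hb : ∀ n, ∫⁻ t, ‖φ n t‖ₑ ^ θ ∂ν ≤ M) {g : T → V}
    (hlim : ∀ᵐ t ∂ν, Tendsto (fun n => φ n t) atTop (𝓝 (g t))) :
    Tendsto (fun n => ∫ t, φ n t ∂ν) atTop (𝓝 (∫ t, g t ∂ν)) := by
  have hθ0 : 0 ≤ θ := by linarith
  have hg := aestronglyMeasurable_of_tendsto_ae _ hφ hlim
  have hgi : Integrable g ν := integrable_of_lintegral_enorm_rpow hθ hg
    (ne_top_of_le_ne_top hM (lintegral_enorm_rpow_le_of_ae_tendsto hφ hb hlim))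
  have hφi : ∀ n, Integrable (φ n) ν := fun n =>
    integrable_of_lintegral_enorm_rpow hθ (hφ n) (ne_top_of_le_ne_top hM (hb n))
  have hui : UnifIntegrable φ 1 ν := by
    refine unifIntegrable_of le_rfl ENNReal.one_ne_top hφ fun ε hε => ?_
    obtain ⟨R, hR1, hR⟩ := exists_forall_mul_le_rpow hθ (M.toReal / ε)
    refine ⟨R, fun n => ?_⟩
    have hpt : ∀ t, ENNReal.ofReal (M.toReal / ε) * ‖{t | R ≤ ‖φ n t‖₊}.indicator (φ n) t‖ₑ ≤
        ‖φ n t‖ₑ ^ θ := fun t => by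
      by_cases ht : R ≤ ‖φ n t‖₊
      · rw [indicator_of_mem (show t ∈ {t | R ≤ ‖φ n t‖₊} from ht), ← ofReal_norm,
          ENNReal.ofReal_rpow_of_nonneg (norm_nonneg _) hθ0,
          ← ENNReal.ofReal_mul (by positivity)]
        exact ENNReal.ofReal_le_ofReal (hR _ ht)
      · rw [indicator_of_notMem (show t ∉ {t | R ≤ ‖φ n t‖₊} from ht)]; simp
    rw [eLpNorm_one_eq_lintegral_enorm]
    rcases eq_or_ne M 0 with hM0 | hM0
    · have h0 : φ n =ᵐ[ν] 0 := by
        have := (lintegral_eq_zero_iff' ((hφ n).enorm.pow_const θ)).1 (le_antisymm (hM0 ▸ hb n) bot_le)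
        filter_upwards [this] with t ht
        simpa [ENNReal.rpow_eq_zero_iff, (by linarith : 0 < θ), hθ0.not_gt] using ht
      have : ∫⁻ t, ‖{t | R ≤ ‖φ n t‖₊}.indicator (φ n) t‖ₑ ∂ν = 0 := by
        refine (lintegral_congr_ae (g := fun _ => 0) ?_).trans (by simp)
        filter_upwards [h0] with t ht
        by_cases h : t ∈ {t | R ≤ ‖φ n t‖₊} <;> simp [indicator, h, ht]
      rw [this]; exact bot_le
    · have hMpos : 0 < M.toReal := ENNReal.toReal_pos hM0 hM
      have h1 : ENNReal.ofReal (M.toReal / ε) *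
          ∫⁻ t, ‖{t | R ≤ ‖φ n t‖₊}.indicator (φ n) t‖ₑ ∂ν ≤ M := by
        rw [← lintegral_const_mul' _ _ ENNReal.ofReal_ne_top]
        exact (lintegral_mono hpt).trans (hb n)
      rw [ENNReal.ofReal_div_of_pos hε, ENNReal.ofReal_toReal hM] at h1
      have h2 : M * ∫⁻ t, ‖{t | R ≤ ‖φ n t‖₊}.indicator (φ n) t‖ₑ ∂ν ≤ M * ENNReal.ofReal ε := by
        have h3 := mul_le_mul_left h1 (ENNReal.ofReal ε)
        rwa [mul_right_comm, ENNReal.div_mul_cancel (by simpa using hε) ENNReal.ofReal_ne_top] at h3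
      exact (ENNReal.mul_le_mul_iff_right hM0 hM).1 h2
  exact tendsto_integral_of_L1' _ hgi.1 (Eventually.of_forall hφi)
    (tendsto_Lp_finite_of_tendsto_ae le_rfl ENNReal.one_ne_top hφ (memLp_one_iff_integrable.2 hgi)
      hui hlim)

theorem exists_isFiniteMeasure_le_absolutelyContinuous {T : Type*} [MeasurableSpace T]
    (μ : Measure T) [SigmaFinite μ] : ∃ ν : Measure T, IsFiniteMeasure ν ∧ ν ≤ μ ∧ μ ≪ ν := by
  obtain ⟨g, hg0, hgm, hg⟩ := exists_pos_lintegral_lt_of_sigmaFinite μ one_ne_zero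
  have hm : Measurable fun t => min (g t : ℝ≥0∞) 1 := hgm.coe_nnreal_ennreal.min measurable_const
  refine ⟨μ.withDensity fun t => min (g t : ℝ≥0∞) 1, ?_, ?_, ?_⟩
  · exact isFiniteMeasure_withDensity (ne_top_of_le_ne_top hg.ne_top
      (lintegral_mono fun t => min_le_left _ _))
  · calc μ.withDensity (fun t => min (g t : ℝ≥0∞) 1) ≤ μ.withDensity 1 :=
          withDensity_mono (Eventually.of_forall fun t => min_le_right _ _)
      _ = μ := withDensity_one
  · exact withDensity_absolutelyContinuous' hm.aemeasurable
      (Eventually.of_forall fun t => by simp [(hg0 t).ne'])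

theorem convex_setOf_lintegral_enorm_rpow_le {V : Type*} [NormedAddCommGroup V] [NormedSpace ℝ V]
    {T : Type*} [MeasurableSpace T] (μ : Measure T) {θ : ℝ} (hθ : 1 ≤ θ) (M : ℝ≥0∞) :
    Convex ℝ {φ : T → V | AEStronglyMeasurable φ μ ∧ ∫⁻ t, ‖φ t‖ₑ ^ θ ∂μ ≤ M} := by
  rintro φ ⟨hφ, hφM⟩ ψ ⟨hψ, hψM⟩ s r hs hr hsr
  have hsr' : ENNReal.ofReal s + ENNReal.ofReal r = 1 := by
    rw [← ENNReal.ofReal_add hs hr, hsr, ENNReal.ofReal_one]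
  refine ⟨(hφ.const_smul s).add (hψ.const_smul r), ?_⟩
  calc ∫⁻ t, ‖s • φ t + r • ψ t‖ₑ ^ θ ∂μ
      ≤ ∫⁻ t, (ENNReal.ofReal s * ‖φ t‖ₑ ^ θ + ENNReal.ofReal r * ‖ψ t‖ₑ ^ θ) ∂μ := by
        refine lintegral_mono fun t => ?_
        refine le_trans ?_ (ENNReal.rpow_arith_mean_le_arith_mean2_rpow _ _ _ _ hsr' hθ)
        refine ENNReal.rpow_le_rpow ((enorm_add_le _ _).trans_eq ?_) (by linarith)
        rw [enorm_smul, enorm_smul, Real.enorm_of_nonneg hs, Real.enorm_of_nonneg hr]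
    _ = ENNReal.ofReal s * ∫⁻ t, ‖φ t‖ₑ ^ θ ∂μ + ENNReal.ofReal r * ∫⁻ t, ‖ψ t‖ₑ ^ θ ∂μ := by
        rw [lintegral_add_left' ((hφ.enorm.pow_const _).const_mul _),
          lintegral_const_mul' _ _ ENNReal.ofReal_ne_top,
          lintegral_const_mul' _ _ ENNReal.ofReal_ne_top]
    _ ≤ ENNReal.ofReal s * M + ENNReal.ofReal r * M := by gcongr
    _ = M := by rw [← add_mul, hsr', one_mul]

theorem convex_setOf_lintegral_ofReal_le {T : Type*} [MeasurableSpace T] (μ : Measure T)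
    (c : ℝ≥0∞) :
    Convex ℝ {φ : T → ℝ | AEMeasurable φ μ ∧ ∫⁻ t, ENNReal.ofReal (φ t) ∂μ ≤ c} := by
  rintro φ ⟨hφ, hφM⟩ ψ ⟨hψ, hψM⟩ s r hs hr hsr
  have hsr' : ENNReal.ofReal s + ENNReal.ofReal r = 1 := by
    rw [← ENNReal.ofReal_add hs hr, hsr, ENNReal.ofReal_one]
  refine ⟨(hφ.const_smul s).add (hψ.const_smul r), ?_⟩
  calc ∫⁻ t, ENNReal.ofReal (s • φ t + r • ψ t) ∂μ
      ≤ ∫⁻ t, (ENNReal.ofReal s * ENNReal.ofReal (φ t) +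
          ENNReal.ofReal r * ENNReal.ofReal (ψ t)) ∂μ := by
        refine lintegral_mono fun t => ENNReal.ofReal_add_le.trans_eq ?_
        rw [smul_eq_mul, smul_eq_mul, ENNReal.ofReal_mul hs, ENNReal.ofReal_mul hr]
    _ = ENNReal.ofReal s * ∫⁻ t, ENNReal.ofReal (φ t) ∂μ +
          ENNReal.ofReal r * ∫⁻ t, ENNReal.ofReal (ψ t) ∂μ := by
        rw [lintegral_add_left' (hφ.ennreal_ofReal.const_mul _),
          lintegral_const_mul' _ _ ENNReal.ofReal_ne_top,
          lintegral_const_mul' _ _ ENNReal.ofReal_ne_top]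
    _ ≤ ENNReal.ofReal s * c + ENNReal.ofReal r * c := by gcongr
    _ = c := by rw [← add_mul, hsr', one_mul]

/-- Lower closure theorem for superlinear Lagrangians which are convex in the velocity. -/
theorem exists_velocity_lintegral_le_of_tendsto {X V : Type*} [TopologicalSpace X]
    [NormedAddCommGroup V] [NormedSpace ℝ V] [FiniteDimensional ℝ V] {f : ℝ → X → V → ℝ}
    {α θ : ℝ} (hα : 0 < α) (hθ : 1 < θ)
    (hf : ∀ᵐ t ∂(volume.restrict (Ioi (0 : ℝ))), Continuous (Function.uncurry (f t)) ∧
      (∀ x, ConvexOn ℝ univ (f t x)) ∧ ∀ x p, α * ‖p‖ ^ θ ≤ f t x p)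
    {x : ℕ → ℝ → X} {x' : ℝ → X} (hx : ∀ t, Tendsto (fun n => x n t) atTop (𝓝 (x' t)))
    {g : ℕ → ℝ → V} (hg : ∀ n, AEStronglyMeasurable (g n) (volume.restrict (Ioi (0 : ℝ))))
    {M : ℝ≥0∞} (hM : M ≠ ⊤) (hgM : ∀ n, ∫⁻ t in Ioi (0 : ℝ), ‖g n t‖ₑ ^ θ ≤ M)
    {η : ℕ → ℝ≥0 → V} {η' : ℝ≥0 → V} (hη : ∀ t, Tendsto (fun n => η n t) atTop (𝓝 (η' t)))
    (hηg : ∀ n (t : ℝ≥0), η n t = ∫ s in Ioc (0 : ℝ) t, g n s)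
    {E : ℕ → Set ℝ} {E' : Set ℝ} (hE : ∀ t ∈ E', ∀ᶠ n in atTop, t ∈ E n)
    (hwm : ∀ n, AEMeasurable ((E n).indicator fun t => f t (x n t) (g n t))
      (volume.restrict (Ioi (0 : ℝ))))
    {c : ℝ≥0∞} (hw : ∀ n, ∫⁻ t in Ioi (0 : ℝ),
      ENNReal.ofReal ((E n).indicator (fun t => f t (x n t) (g n t)) t) ≤ c) :
    ∃ g' : ℝ → V, AEStronglyMeasurable g' (volume.restrict (Ioi (0 : ℝ))) ∧
      ∫⁻ t in Ioi (0 : ℝ), ‖g' t‖ₑ ^ θ ≤ M ∧ (∀ t : ℝ≥0, η' t = ∫ s in Ioc (0 : ℝ) t, g' s) ∧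
      ∫⁻ t in Ioi (0 : ℝ), ENNReal.ofReal (E'.indicator (fun t => f t (x' t) (g' t)) t) ≤ c := by
  set μ := volume.restrict (Ioi (0 : ℝ)) with hμ
  have hIoc : ∀ t : ℝ≥0, volume.restrict (Ioc (0 : ℝ) t) ≤ μ := fun t =>
    Measure.restrict_mono_set _ Ioc_subset_Ioi_self
  have hint : ∀ φ : ℝ → V, AEStronglyMeasurable φ μ → ∫⁻ t, ‖φ t‖ₑ ^ θ ∂μ ≤ M →
      ∀ t : ℝ≥0, IntegrableOn φ (Ioc (0 : ℝ) t) := fun φ h1 h2 t =>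
    integrable_of_lintegral_enorm_rpow hθ (h1.mono_measure (hIoc t))
      (ne_top_of_le_ne_top hM ((lintegral_mono' (hIoc t) le_rfl).trans h2))
  set S : Set ((ℝ → V) × (ℝ → ℝ) × (ℝ≥0 → V)) := {z |
    (AEStronglyMeasurable z.1 μ ∧ ∫⁻ t, ‖z.1 t‖ₑ ^ θ ∂μ ≤ M) ∧
    (AEMeasurable z.2.1 μ ∧ ∫⁻ t, ENNReal.ofReal (z.2.1 t) ∂μ ≤ c) ∧
    ∀ t : ℝ≥0, z.2.2 t = ∫ s in Ioc (0 : ℝ) t, z.1 s} with hS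
  have hSconv : Convex ℝ S := by
    rintro z ⟨hz1, hz2, hz3⟩ z' ⟨hz1', hz2', hz3'⟩ s r hs hr hsr
    refine ⟨convex_setOf_lintegral_enorm_rpow_le μ hθ.le M hz1 hz1' hs hr hsr,
      convex_setOf_lintegral_ofReal_le μ c hz2 hz2' hs hr hsr, fun t => ?_⟩
    change s • z.2.2 t + r • z'.2.2 t = ∫ u in Ioc (0 : ℝ) t, (s • z.1 u + r • z'.1 u)
    rw [integral_add (f := fun u => s • z.1 u) (g := fun u => r • z'.1 u)
      ((hint _ hz1.1 hz1.2 t).smul s) ((hint _ hz1'.1 hz1'.2 t).smul r),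
      integral_smul, integral_smul, hz3, hz3']
  set w : ℕ → ℝ → ℝ := fun n => (E n).indicator fun t => f t (x n t) (g n t) with hwdef
  set A : ℕ → Set ((ℝ → V) × (ℝ → ℝ) × (ℝ≥0 → V)) := fun k =>
    convexHull ℝ ((fun j => (g j, w j, η j)) '' Ici k) with hA
  have hAle : ∀ {k : ℕ} {D : Set ((ℝ → V) × (ℝ → ℝ) × (ℝ≥0 → V))}, Convex ℝ D →
      (∀ j, k ≤ j → (g j, w j, η j) ∈ D) → A k ⊆ D := fun hD h =>
    convexHull_min (by rintro _ ⟨j, hj, rfl⟩; exact h j hj) hD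
  have hAS : ∀ k, A k ⊆ S := fun k =>
    hAle hSconv fun j _ => ⟨⟨hg j, hgM j⟩, ⟨hwm j, hw j⟩, hηg j⟩
  obtain ⟨ν, hν, hνμ, hμν⟩ := exists_isFiniteMeasure_le_absolutelyContinuous μ
  let L : ((ℝ → V) × (ℝ → ℝ) × (ℝ≥0 → V)) →ₗ[ℝ]
      (ℝ → EuclideanSpace ℝ (Fin (Module.finrank ℝ V))) :=
    { toFun := fun z t => toEuclidean (z.1 t)
      map_add' := fun z z' => by ext t : 1; simp
      map_smul' := fun s z => by ext t : 1; simp }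
  have hLint : ∀ z ∈ A 0, Integrable z.1 ν := fun z hz =>
    integrable_of_lintegral_enorm_rpow hθ ((hAS 0 hz).1.1.mono_measure hνμ)
      (ne_top_of_le_ne_top hM ((lintegral_mono' hνμ le_rfl).trans (hAS 0 hz).1.2))
  have hbd : ∀ z ∈ A 0, ∫ t, ‖z.1 t‖ ∂ν ≤ (ν univ + M).toReal := fun z hz => by
    rw [integral_norm_eq_lintegral_enorm (hLint z hz).1]
    refine ENNReal.toReal_mono (by finiteness) ?_
    calc ∫⁻ t, ‖z.1 t‖ₑ ∂ν ≤ ∫⁻ t, (1 + ‖z.1 t‖ₑ ^ θ) ∂ν := lintegral_mono fun t => by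
          rcases le_total ‖z.1 t‖ₑ 1 with h | h
          · exact h.trans le_self_add
          · exact (ENNReal.le_rpow_self_of_one_le h hθ.le).trans le_add_self
      _ = ν univ + ∫⁻ t, ‖z.1 t‖ₑ ^ θ ∂ν := by
          rw [lintegral_add_left measurable_const]; simp
      _ ≤ ν univ + M := by
          gcongr; exact (lintegral_mono' hνμ le_rfl).trans (hAS 0 hz).1.2
  obtain ⟨z, hzA, hzlim⟩ := exists_mem_ae_tendsto_of_antitone_convex (ν := ν) L
    (A := A) (fun k k' hk => convexHull_mono (image_mono (Ici_subset_Ici.2 hk)))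
    (fun k => convex_convexHull ℝ _)
    (fun k => ⟨_, subset_convexHull ℝ _ ⟨k, mem_Ici.2 le_rfl, rfl⟩⟩)
    (fun z hz => (toEuclidean (E := V)).toContinuousLinearMap.integrable_comp (hLint z hz))
    (M := ‖(toEuclidean (E := V)).toContinuousLinearMap‖ * (ν univ + M).toReal)
    (fun z hz => by
      calc ∫ t, ‖L z t‖ ∂ν ≤ ∫ t, ‖(toEuclidean (E := V)).toContinuousLinearMap‖ * ‖z.1 t‖ ∂ν :=
            integral_mono
              ((toEuclidean (E := V)).toContinuousLinearMap.integrable_comp (hLint z hz)).norm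
              ((hLint z hz).norm.const_mul _)
              fun t => (toEuclidean (E := V)).toContinuousLinearMap.le_opNorm (z.1 t)
        _ ≤ _ := by
            rw [integral_const_mul]
            exact mul_le_mul_of_nonneg_left (hbd z hz) (norm_nonneg _))
  have hzS : ∀ n, z n ∈ S := fun n => hAS n (hzA n)
  set g' : ℝ → V := fun t => limUnder atTop fun n => (z n).1 t with hg'
  have hlim : ∀ᵐ t ∂μ, Tendsto (fun n => (z n).1 t) atTop (𝓝 (g' t)) := by
    refine hμν.ae_le ?_
    filter_upwards [hzlim] with t ⟨l, hl⟩
    refine tendsto_nhds_limUnder ⟨(toEuclidean (E := V)).symm l, ?_⟩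
    have := ((toEuclidean (E := V)).symm.continuous.tendsto l).comp hl
    refine this.congr fun n => ?_
    change (toEuclidean (E := V)).symm (toEuclidean ((z n).1 t)) = _
    simp
  refine ⟨g', aestronglyMeasurable_of_tendsto_ae _ (fun n => (hzS n).1.1) hlim,
    lintegral_enorm_rpow_le_of_ae_tendsto (fun n => (hzS n).1.1) (fun n => (hzS n).1.2) hlim,
    fun t => ?_, ?_⟩
  · have h1 : Tendsto (fun n => (z n).2.2 t) atTop (𝓝 (η' t)) := by
      rw [Metric.tendsto_atTop']
      intro ε hε
      obtain ⟨k, hk⟩ := eventually_atTop.1 ((hη t).eventually (Metric.ball_mem_nhds _ hε))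
      refine ⟨k, fun n hn => ?_⟩
      have hD : Convex ℝ {y : (ℝ → V) × (ℝ → ℝ) × (ℝ≥0 → V) | y.2.2 t ∈ Metric.ball (η' t) ε} :=
        fun y hy y' hy' s r hs hr hsr => convex_ball (η' t) ε hy hy' hs hr hsr
      exact hAle hD (fun j hj => hk j (hn.le.trans hj)) (hzA n)
    have h2 : Tendsto (fun n => (z n).2.2 t) atTop (𝓝 (∫ s in Ioc (0 : ℝ) t, g' s)) := by
      simp_rw [(hzS _).2.2 t]
      exact tendsto_integral_of_lintegral_enorm_rpow_le hθ
        (fun n => (hzS n).1.1.mono_measure (hIoc t)) hM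
        (fun n => (lintegral_mono' (hIoc t) le_rfl).trans (hzS n).1.2)
        ((Measure.absolutelyContinuous_of_le (hIoc t)).ae_le hlim)
    exact tendsto_nhds_unique h1 h2
  · calc ∫⁻ t, ENNReal.ofReal (E'.indicator (fun t => f t (x' t) (g' t)) t) ∂μ
        ≤ ∫⁻ t, liminf (fun n => ENNReal.ofReal ((z n).2.1 t)) atTop ∂μ := by
          refine lintegral_mono_ae ?_
          filter_upwards [hlim, hf] with t ht ⟨hfc, hfv, hfl⟩
          by_cases htE : t ∈ E'
          swap
          · simp [htE]
          rw [indicator_of_mem htE]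
          refine le_of_forall_lt fun r hr => ?_
          have hr' : r.toReal < f t (x' t) (g' t) := (ENNReal.lt_ofReal_iff_toReal_lt hr.ne_top).1 hr
          obtain ⟨r₁, hrr₁, hr₁⟩ := exists_between hr'
          obtain ⟨ξ, b, hξ, hev⟩ := exists_affine_le_eventually hfc hfv hα hθ hfl _ _ hr₁
          obtain ⟨k, hk⟩ := eventually_atTop.1 ((hE t htE).and ((hx t).eventually hev))
          have hD : Convex ℝ {y : (ℝ → V) × (ℝ → ℝ) × (ℝ≥0 → V) | ξ (y.1 t) + b ≤ y.2.1 t} := by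
            intro y hy y' hy' s r hs hr hsr
            change ξ (s • y.1 t + r • y'.1 t) + b ≤ s • y.2.1 t + r • y'.2.1 t
            have hb : b = s * b + r * b := by rw [← add_mul, hsr, one_mul]
            rw [map_add, map_smul, map_smul, hb]
            have h1 := mul_le_mul_of_nonneg_left (show ξ (y.1 t) + b ≤ y.2.1 t from hy) hs
            have h2 := mul_le_mul_of_nonneg_left (show ξ (y'.1 t) + b ≤ y'.2.1 t from hy') hr
            simp only [smul_eq_mul]
            linarith
          have hzk : ∀ n ≥ k, ξ ((z n).1 t) + b ≤ (z n).2.1 t := fun n hn =>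
            hAle hD (fun j hj => by
              obtain ⟨hj1, hj2⟩ := hk j (le_trans hn hj)
              change ξ (g j t) + b ≤ w j t
              simp only [hwdef]
              rw [indicator_of_mem hj1]
              exact hj2 _) (hzA n)
          have hξlim : Tendsto (fun n => ξ ((z n).1 t) + b) atTop (𝓝 (ξ (g' t) + b)) :=
            ((ξ.continuous.tendsto _).comp ht).add_const b
          refine lt_of_lt_of_le ((ENNReal.lt_ofReal_iff_toReal_lt hr.ne_top).2 hrr₁)
            (le_liminf_of_le (by isBoundedDefault) ?_)
          filter_upwards [hξlim.eventually (lt_mem_nhds hξ), eventually_ge_atTop k] with n h1 h2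
          exact ENNReal.ofReal_le_ofReal (h1.le.trans (hzk n h2))
      _ ≤ liminf (fun n => ∫⁻ t, ENNReal.ofReal ((z n).2.1 t) ∂μ) atTop :=
          lintegral_liminf_le' fun n => (hzS n).2.1.1.ennreal_ofReal
      _ ≤ c := liminf_le_of_le (by isBoundedDefault) fun b hb' => by
          obtain ⟨n, hn⟩ := hb'.exists; exact hn.trans (hzS n).2.1.2

end LowerClosure

section Velocity

theorem ae_eq_zero_of_forall_setIntegral_Ioc_eq_zero {E : Type*} [NormedAddCommGroup E]
    [NormedSpace ℝ E] [CompleteSpace E] {w : ℝ → E}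
    (hw : ∀ T : ℝ, IntegrableOn w (Icc 0 T)) (h0 : ∀ t : ℝ, 0 < t → ∫ s in Ioc 0 t, w s = 0) :
    ∀ᵐ t ∂volume.restrict (Ioi (0 : ℝ)), w t = 0 := by
  have hloc : LocallyIntegrable ((Ioi (0 : ℝ)).indicator w) volume := by
    refine locallyIntegrable_iff.2 fun k hk => ?_
    obtain ⟨T, hT⟩ := hk.isBounded.subset_closedBall 0
    rw [IntegrableOn, integrable_indicator_iff measurableSet_Ioi, IntegrableOn,
      Measure.restrict_restrict measurableSet_Ioi]
    refine (hw T).mono_set fun x hx => ⟨le_of_lt hx.1, ?_⟩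
    have := hT hx.2
    rw [Real.closedBall_eq_Icc] at this
    simpa using this.2
  rw [ae_restrict_iff' measurableSet_Ioi]
  filter_upwards [LocallyIntegrable.ae_hasDerivAt_integral hloc] with t ht htpos
  have hz : (fun x => ∫ s in (0 : ℝ)..x, (Ioi (0 : ℝ)).indicator w s) =ᶠ[𝓝 t] fun _ => 0 := by
    filter_upwards [Ioi_mem_nhds (show (0 : ℝ) < t from htpos)] with x hx
    rw [intervalIntegral.integral_of_le (le_of_lt hx), setIntegral_indicator measurableSet_Ioi,
      ← h0 x hx]
    congr 2
    ext y
    simp only [mem_inter_iff, mem_Ioc, mem_Ioi]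
    tauto
  have h1 := (ht 0).unique ((hasDerivAt_const t (0 : E)).congr_of_eventuallyEq hz)
  rwa [indicator_of_mem htpos] at h1

variable {Ω : Set (EucSp d)} {γ γ' : CurveSp Ω} {g g' : ℝ → EucSp d}

theorem HasVel.aestronglyMeasurable (hg : HasVel γ g) :
    AEStronglyMeasurable g (volume.restrict (Ioi (0 : ℝ))) := by
  have h : AEStronglyMeasurable g (volume.restrict (⋃ n : ℕ, Icc (0 : ℝ) n)) :=
    (aestronglyMeasurable_iUnion_iff).2 fun n => (hg.1 n).aestronglyMeasurable
  refine h.mono_set fun t ht => mem_iUnion.2 ?_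
  obtain ⟨n, hn⟩ := exists_nat_ge t
  exact ⟨n, le_of_lt ht, hn⟩

theorem HasVel.integrableOn_Ioc (hg : HasVel γ g) (s t : ℝ) (hs : 0 ≤ s) :
    IntegrableOn g (Ioc s t) :=
  (hg.1 t).mono_set (Ioc_subset_Icc_self.trans (Icc_subset_Icc_left hs))

theorem HasVel.ae_eq (hg : HasVel γ g) (hg' : HasVel γ g') :
    g =ᵐ[volume.restrict (Ioi (0 : ℝ))] g' := by
  have h := ae_eq_zero_of_forall_setIntegral_Ioc_eq_zero (w := fun t => g t - g' t)
    (fun T => (hg.1 T).sub (hg'.1 T)) (fun t ht => by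
      rw [integral_sub (hg.integrableOn_Ioc 0 t le_rfl) (hg'.integrableOn_Ioc 0 t le_rfl)]
      have h1 := hg.2 ⟨t, ht.le⟩
      have h2 := hg'.2 ⟨t, ht.le⟩
      rw [h1] at h2
      exact sub_eq_zero.2 (add_left_cancel h2))
  filter_upwards [h] with t ht
  exact sub_eq_zero.1 ht

theorem hasVel_of_lintegral_enorm_rpow_ne_top {θ : ℝ} (hθ : 1 < θ)
    (hgm : AEStronglyMeasurable g (volume.restrict (Ioi (0 : ℝ))))
    (hgθ : ∫⁻ t in Ioi (0 : ℝ), ‖g t‖ₑ ^ θ ≠ ⊤)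
    (h : ∀ t : ℝ≥0, γ.1 t - γ.1 0 = ∫ s in Ioc (0 : ℝ) t, g s) : HasVel γ g := by
  refine ⟨fun T => ?_, fun t => by rw [← h t]; abel⟩
  rw [integrableOn_Icc_iff_integrableOn_Ioc]
  refine integrable_of_lintegral_enorm_rpow hθ (hgm.mono_set Ioc_subset_Ioi_self)
    (ne_top_of_le_ne_top hgθ (lintegral_mono_set Ioc_subset_Ioi_self))

theorem HasVel.sub_eq (hg : HasVel γ g) {s t : ℝ≥0} (hst : s ≤ t) :
    γ.1 t - γ.1 s = ∫ r in Ioc (s : ℝ) t, g r := by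
  have h := setIntegral_union (f := g) (μ := volume) (s := Ioc (0 : ℝ) s) (t := Ioc (s : ℝ) t)
    (Ioc_disjoint_Ioc_of_le le_rfl) measurableSet_Ioc (hg.integrableOn_Ioc 0 s le_rfl)
    (hg.integrableOn_Ioc s t s.2)
  rw [Ioc_union_Ioc_eq_Ioc s.coe_nonneg (NNReal.coe_le_coe.2 hst)] at h
  rw [hg.2 t, hg.2 s, h]
  abel

/-- Functionals of the velocity depending only on its a.e. class. -/
theorem HasVel.iInf_eq (hg : HasVel γ g) {J : (ℝ → EucSp d) → ℝ≥0∞}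
    (hJ : ∀ g', g =ᵐ[volume.restrict (Ioi (0 : ℝ))] g' → J g = J g') :
    ⨅ (g' : ℝ → EucSp d) (_ : HasVel γ g'), J g' = J g :=
  le_antisymm (iInf₂_le g hg) (le_iInf₂ fun g' hg' => (hJ g' (hg.ae_eq hg')).le)

end Velocity

section Caratheodory

/-- A Carathéodory function composed with a measurable one is measurable. -/
theorem AEMeasurable.caratheodory_comp {Z : Type*} [TopologicalSpace Z]
    [TopologicalSpace.MetrizableSpace Z] [SecondCountableTopology Z] [MeasurableSpace Z]
    [BorelSpace Z] {μ : Measure ℝ} {F : ℝ → Z → ℝ} (hm : ∀ z, Measurable fun t => F t z)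
    (hc : ∀ᵐ t ∂μ, Continuous (F t)) {z : ℝ → Z} (hz : AEMeasurable z μ) :
    AEMeasurable (fun t => F t (z t)) μ := by
  obtain ⟨N, hN, hNm, hN0⟩ := exists_measurable_superset_of_null (ae_iff.1 hc)
  have hu : Measurable (Function.uncurry fun t z => Nᶜ.indicator (fun t => F t z) t) := by
    refine (measurable_uncurry_of_continuous_of_measurable
      (u := fun (z : Z) (t : ℝ) => Nᶜ.indicator (fun t => F t z) t) (fun t => ?_)
      fun z => (hm z).indicator hNm.compl).comp measurable_swap
    by_cases ht : t ∈ N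
    · simpa [indicator, ht] using continuous_const
    · have : Continuous (F t) := by
        by_contra hcon
        exact ht (hN hcon)
      simpa [indicator, ht] using this
  refine ⟨fun t => Nᶜ.indicator (fun s => F s (hz.mk z t)) t, ?_, ?_⟩
  · exact hu.comp (measurable_id.prodMk hz.measurable_mk)
  · filter_upwards [hz.ae_eq_mk, compl_mem_ae_iff.2 hN0] with t ht htN
    rw [indicator_of_mem htN, ← ht]
end Caratheodory

section ExitTime

variable {Ω Ξ : Set (EucSp d)}

theorem lowerSemicontinuous_exitT (hΞ : IsClosed Ξ) :
    LowerSemicontinuous (exitT Ξ : CurveSp Ω → ℝ≥0∞) := by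
  intro γ r hr
  obtain ⟨r', hrr', hr'⟩ := ENNReal.lt_iff_exists_nnreal_btwn.1 hr
  have hopen : IsOpen {η : C(ℝ≥0, EucSp d) | MapsTo η (Icc 0 r') Ξᶜ} :=
    ContinuousMap.isOpen_setOfPred_mapsTo isCompact_Icc hΞ.isOpen_compl
  have hmem : (γ : C(ℝ≥0, EucSp d)) ∈ {η : C(ℝ≥0, EucSp d) | MapsTo η (Icc 0 r') Ξᶜ} := by
    intro t ht htΞ
    exact (hr'.trans_le (iInf₂_le t htΞ)).not_ge (by exact_mod_cast ht.2)
  filter_upwards [continuous_subtype_val.continuousAt.preimage_mem_nhds (hopen.mem_nhds hmem)]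
    with η hη
  refine hrr'.trans_le (le_iInf₂ fun t ht => ?_)
  by_contra hlt
  exact hη ⟨zero_le, by exact_mod_cast (not_le.1 hlt).le⟩ ht

variable {Ψ : ℝ → ℝ}

theorem exists_lt_of_lt_PsiExt (hΨ : LowerSemicontinuousOn Ψ (Ici 0)) {T r : ℝ≥0∞}
    (h : r < PsiExt Ψ T) :
    ∃ t : ℝ≥0, r < ENNReal.ofReal (Ψ t) ∧ (t = 0 ∨ (t : ℝ≥0∞) < T) := by
  obtain ⟨t, ht⟩ := lt_iSup_iff.1 h
  obtain ⟨htT, ht⟩ := lt_iSup_iff.1 ht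
  rcases eq_or_ne t 0 with h0 | h0
  · exact ⟨t, ht, Or.inl h0⟩
  have hrtop : r ≠ ⊤ := ne_top_of_lt ht
  have hlt : r.toReal < Ψ t := (ENNReal.lt_ofReal_iff_toReal_lt hrtop).1 ht
  have hpos : (0 : ℝ) < t := by exact_mod_cast pos_iff_ne_zero.2 h0
  have hev : ∀ᶠ s in 𝓝[<] (t : ℝ), 0 < s ∧ r.toReal < Ψ s ∧ s < t := by
    have h1 : ∀ᶠ s in 𝓝[<] (t : ℝ), 0 < s := nhdsWithin_le_nhds (Ioi_mem_nhds hpos)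
    have h2 := eventually_nhdsWithin_iff.1 (hΨ t hpos.le _ hlt)
    filter_upwards [h1, nhdsWithin_le_nhds h2, self_mem_nhdsWithin] with s hs hs2 hs3
    exact ⟨hs, hs2 hs.le, hs3⟩
  obtain ⟨s, hs0, hs, hst⟩ := hev.exists
  refine ⟨⟨s, hs0.le⟩, (ENNReal.lt_ofReal_iff_toReal_lt hrtop).2 hs, Or.inr ?_⟩
  exact lt_of_lt_of_le (ENNReal.coe_lt_coe.2 (NNReal.coe_lt_coe.1 hst)) htT

theorem lowerSemicontinuous_PsiExt_exitT (hΨ : LowerSemicontinuousOn Ψ (Ici 0))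
    (hΞ : IsClosed Ξ) : LowerSemicontinuous fun γ : CurveSp Ω => PsiExt Ψ (exitT Ξ γ) := by
  intro γ r hr
  obtain ⟨t, hrt, rfl | ht⟩ := exists_lt_of_lt_PsiExt hΨ hr
  · exact Eventually.of_forall fun η => hrt.trans_le (le_iSup₂_of_le 0 zero_le le_rfl)
  · filter_upwards [lowerSemicontinuous_exitT hΞ γ _ ht] with η hη
    exact hrt.trans_le (le_iSup₂_of_le t hη.le le_rfl)

theorem le_of_affine_le_PsiExt {a b : ℝ} (ha : 0 < a)
    (hΨ : ∀ t ∈ Ici (0 : ℝ), a * t - b ≤ Ψ t) (T : ℝ≥0∞) :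
    T ≤ (PsiExt Ψ T + ENNReal.ofReal b) / ENNReal.ofReal a := by
  rw [ENNReal.le_div_iff_mul_le (Or.inl (by simpa using ha)) (Or.inl ENNReal.ofReal_ne_top)]
  have key : ∀ t : ℝ≥0, (t : ℝ≥0∞) ≤ T →
      (t : ℝ≥0∞) * ENNReal.ofReal a ≤ PsiExt Ψ T + ENNReal.ofReal b := by
    intro t ht
    calc (t : ℝ≥0∞) * ENNReal.ofReal a = ENNReal.ofReal (t * a) := by
          rw [ENNReal.ofReal_mul t.coe_nonneg, ENNReal.ofReal_coe_nnreal]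
      _ ≤ ENNReal.ofReal (Ψ t + b) :=
          ENNReal.ofReal_le_ofReal (by linarith [hΨ t t.2, mul_comm a (t : ℝ)])
      _ ≤ ENNReal.ofReal (Ψ t) + ENNReal.ofReal b := ENNReal.ofReal_add_le
      _ ≤ _ := by gcongr; exact le_iSup₂_of_le t ht le_rfl
  by_contra hcon
  rw [not_le] at hcon
  have h1 : (PsiExt Ψ T + ENNReal.ofReal b) / ENNReal.ofReal a < T := by
    rw [ENNReal.div_lt_iff (Or.inl (by simpa using ha)) (Or.inl ENNReal.ofReal_ne_top)]
    exact hcon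
  obtain ⟨t, ht, htT⟩ := ENNReal.lt_iff_exists_nnreal_btwn.1 h1
  rw [ENNReal.div_lt_iff (Or.inl (by simpa using ha)) (Or.inl ENNReal.ofReal_ne_top)] at ht
  exact (key t htT.le).not_gt ht

end ExitTime

section RunningCost

/-- The structural assumptions on the running cost `ℓ`. -/
structure IsRunningCost (Ω : Set (EucSp d)) (ℓ : ℝ → EucSp d → EucSp d → ℝ) (α θ : ℝ) :
    Prop where
  pos : 0 < α
  one_lt : 1 < θ
  measurable : ∀ x p, Measurable fun t : ℝ => ℓ t x p
  ae_continuousOn : ∀ᵐ t ∂(volume.restrict (Ioi (0 : ℝ))),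
    ContinuousOn (fun q : EucSp d × EucSp d => ℓ t q.1 q.2) (closure Ω ×ˢ univ)
  ae_convexOn : ∀ᵐ t ∂(volume.restrict (Ioi (0 : ℝ))), ∀ x ∈ closure Ω,
    ConvexOn ℝ univ fun p => ℓ t x p
  le : ∀ t ∈ Ici (0 : ℝ), ∀ x ∈ closure Ω, ∀ p, α * ‖p‖ ^ θ ≤ ℓ t x p

variable {Ω : Set (EucSp d)}

/-- The position of a curve, extended to negative times by its initial value. -/
def curvePos (γ : CurveSp Ω) (t : ℝ) : closure Ω :=
  ⟨γ.1 t.toNNReal, γ.2 _⟩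

theorem continuous_curvePos (γ : CurveSp Ω) : Continuous (curvePos γ) :=
  (γ.1.continuous.comp continuous_real_toNNReal).subtype_mk _

theorem tendsto_curvePos {γ : ℕ → CurveSp Ω} {γ' : CurveSp Ω} (h : Tendsto γ atTop (𝓝 γ'))
    (t : ℝ) : Tendsto (fun n => curvePos (γ n) t) atTop (𝓝 (curvePos γ' t)) :=
  tendsto_subtype_rng.2
    (((continuous_eval_const t.toNNReal).comp continuous_subtype_val).tendsto γ'
      |>.comp h)

theorem tendsto_curve_sub {γ : ℕ → CurveSp Ω} {γ' : CurveSp Ω} (h : Tendsto γ atTop (𝓝 γ'))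
    (t : ℝ≥0) : Tendsto (fun n => (γ n).1 t - (γ n).1 0) atTop (𝓝 (γ'.1 t - γ'.1 0)) := by
  have key : ∀ t : ℝ≥0, Tendsto (fun n => (γ n).1 t) atTop (𝓝 (γ'.1 t)) := fun t =>
    ((continuous_eval_const t).comp continuous_subtype_val).tendsto γ' |>.comp h
  exact (key t).sub (key 0)

/-- The integral of the running cost along a curve. -/
def runCost (ℓ : ℝ → EucSp d → EucSp d → ℝ) (γ : CurveSp Ω) : ℝ≥0∞ :=
  ⨅ (g : ℝ → EucSp d) (_ : HasVel γ g),
    ∫⁻ t in Ioi (0 : ℝ), ENNReal.ofReal (ℓ t (γ.1 t.toNNReal) (g t))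

variable {ℓ : ℝ → EucSp d → EucSp d → ℝ} {α θ : ℝ} {γ : CurveSp Ω} {g : ℝ → EucSp d}

theorem HasVel.runCost_eq (hg : HasVel γ g) :
    runCost ℓ γ = ∫⁻ t in Ioi (0 : ℝ), ENNReal.ofReal (ℓ t (γ.1 t.toNNReal) (g t)) :=
  hg.iInf_eq (J := fun g => ∫⁻ t in Ioi (0 : ℝ), ENNReal.ofReal (ℓ t (γ.1 t.toNNReal) (g t)))
    fun g' h => lintegral_congr_ae (by filter_upwards [h] with t ht; rw [ht])

theorem exists_hasVel_of_runCost_ne_top (h : runCost ℓ γ ≠ ⊤) : ∃ g, HasVel γ g := by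
  by_contra! hcon
  exact h (by simp [runCost, hcon])

theorem IsRunningCost.aemeasurable (hℓ : IsRunningCost Ω ℓ α θ) (hg : HasVel γ g) :
    AEMeasurable (fun t => ℓ t (γ.1 t.toNNReal) (g t)) (volume.restrict (Ioi (0 : ℝ))) := by
  refine AEMeasurable.caratheodory_comp (Z := closure Ω × EucSp d)
    (F := fun t z => ℓ t z.1 z.2) (z := fun t => (curvePos γ t, g t))
    (fun z => hℓ.measurable z.1 z.2) ?_
    ((continuous_curvePos γ).measurable.aemeasurable.prodMk hg.aestronglyMeasurable.aemeasurable)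
  filter_upwards [hℓ.ae_continuousOn] with t ht
  exact ht.comp_continuous (f := fun z : closure Ω × EucSp d => ((z.1 : EucSp d), z.2))
    (by fun_prop) fun z => ⟨z.1.2, mem_univ _⟩

theorem IsRunningCost.mul_lintegral_le (hℓ : IsRunningCost Ω ℓ α θ) (hg : HasVel γ g) :
    ENNReal.ofReal α * ∫⁻ t in Ioi (0 : ℝ), ‖g t‖ₑ ^ θ ≤ runCost ℓ γ := by
  rw [hg.runCost_eq, ← lintegral_const_mul' _ _ ENNReal.ofReal_ne_top]
  refine setLIntegral_mono_ae' measurableSet_Ioi (ae_of_all _ fun t ht => ?_)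
  rw [← ofReal_norm, ENNReal.ofReal_rpow_of_nonneg (norm_nonneg _)
    (by linarith [hℓ.one_lt]), ← ENNReal.ofReal_mul hℓ.pos.le]
  exact ENNReal.ofReal_le_ofReal (hℓ.le t (mem_Ici.2 (le_of_lt ht)) _ (γ.2 _) _)

theorem IsRunningCost.lintegral_le (hℓ : IsRunningCost Ω ℓ α θ) (hg : HasVel γ g)
    {c : ℝ≥0∞} (hc : runCost ℓ γ ≤ c) :
    ∫⁻ t in Ioi (0 : ℝ), ‖g t‖ₑ ^ θ ≤ c / ENNReal.ofReal α := by
  rw [ENNReal.le_div_iff_mul_le (Or.inl (by simpa using hℓ.pos)) (Or.inl ENNReal.ofReal_ne_top),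
    mul_comm]
  exact (hℓ.mul_lintegral_le hg).trans hc

theorem IsRunningCost.runCost_le_of_tendsto (hℓ : IsRunningCost Ω ℓ α θ) {γ : ℕ → CurveSp Ω}
    {γ' : CurveSp Ω} (h : Tendsto γ atTop (𝓝 γ')) {c : ℝ≥0} (hc : ∀ n, runCost ℓ (γ n) ≤ c) :
    runCost ℓ γ' ≤ c := by
  choose g hg using fun n => exists_hasVel_of_runCost_ne_top
    (ne_top_of_le_ne_top ENNReal.coe_ne_top (hc n))
  have hM : (c : ℝ≥0∞) / ENNReal.ofReal α ≠ ⊤ :=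
    ENNReal.div_ne_top ENNReal.coe_ne_top (by simpa using hℓ.pos)
  obtain ⟨g', hg'm, hg'θ, hg'η, hg'c⟩ := exists_velocity_lintegral_le_of_tendsto
    (X := closure Ω) (V := EucSp d) (f := fun t x p => ℓ t x p) hℓ.pos hℓ.one_lt
    (by
      filter_upwards [hℓ.ae_continuousOn, hℓ.ae_convexOn, ae_restrict_mem measurableSet_Ioi]
        with t ht ht' htpos
      exact ⟨ht.comp_continuous (f := fun z : closure Ω × EucSp d => ((z.1 : EucSp d), z.2))
        (by fun_prop) fun z => ⟨z.1.2, mem_univ _⟩, fun x => ht' x x.2,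
        fun x p => hℓ.le t (mem_Ici.2 (le_of_lt htpos)) x x.2 p⟩)
    (tendsto_curvePos h) (fun n => (hg n).aestronglyMeasurable) hM
    (fun n => hℓ.lintegral_le (hg n) (hc n)) (tendsto_curve_sub h)
    (fun n t => by rw [(hg n).2 t]; abel) (E := fun _ => univ) (E' := univ)
    (fun _ _ => Eventually.of_forall fun _ => mem_univ _)
    (fun n => by simpa only [indicator_univ, curvePos] using hℓ.aemeasurable (hg n)) (c := c)
    (fun n => by simpa only [indicator_univ, curvePos] using ((hg n).runCost_eq (ℓ := ℓ)).symm.trans_le (hc n))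
  have hv := hasVel_of_lintegral_enorm_rpow_ne_top hℓ.one_lt hg'm
    (ne_top_of_le_ne_top hM hg'θ) hg'η
  rw [hv.runCost_eq]
  simpa only [indicator_univ, curvePos] using hg'c

instance : TopologicalSpace.MetrizableSpace (CurveSp Ω) :=
  have : TopologicalSpace.MetrizableSpace C(ℝ≥0, EucSp d) := UniformSpace.metrizableSpace
  IsEmbedding.subtypeVal.metrizableSpace

theorem IsRunningCost.lowerSemicontinuous_runCost (hℓ : IsRunningCost Ω ℓ α θ) :
    LowerSemicontinuous (runCost ℓ : CurveSp Ω → ℝ≥0∞) := by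
  rw [lowerSemicontinuous_iff_isClosed_preimage]
  intro y
  induction y with
  | top => simp
  | coe c => exact IsSeqClosed.isClosed fun γ γ' hγ h => hℓ.runCost_le_of_tendsto h hγ

end RunningCost

section Interaction

/-- The structural assumptions on the interaction cost `h`. -/
structure IsInteraction (Ω : Set (EucSp d)) (h : ℝ → EucSp d → EucSp d → EucSp d → EucSp d → ℝ)
    (C β : ℝ) : Prop where
  const_pos : 0 < C
  exponent_pos : 0 < β
  measurable : ∀ x x' p p', Measurable fun t : ℝ => h t x x' p p'
  ae_continuousOn : ∀ᵐ t ∂(volume.restrict (Ioi (0 : ℝ))),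
    ContinuousOn
      (fun q : (EucSp d × EucSp d) × EucSp d × EucSp d => h t q.1.1 q.1.2 q.2.1 q.2.2)
      ((closure Ω ×ˢ closure Ω) ×ˢ univ)
  ae_convexOn : ∀ᵐ t ∂(volume.restrict (Ioi (0 : ℝ))), ∀ x ∈ closure Ω, ∀ x' ∈ closure Ω,
    ConvexOn ℝ univ fun q : EucSp d × EucSp d => h t x x' q.1 q.2
  symm : ∀ t x x' p p', h t x x' p p' = h t x' x p' p
  nonneg : ∀ t ∈ Ici (0 : ℝ), ∀ x ∈ closure Ω, ∀ x' ∈ closure Ω, ∀ p p', 0 ≤ h t x x' p p'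
  le : ∀ t ∈ Ici (0 : ℝ), ∀ x ∈ closure Ω, ∀ x' ∈ closure Ω, ∀ p p',
    h t x x' p p' ≤ C * (‖p‖ ^ β + ‖p'‖ ^ β)

variable {Ω Ξ : Set (EucSp d)} {h : ℝ → EucSp d → EucSp d → EucSp d → EucSp d → ℝ} {C β : ℝ}
  {γ γ' : CurveSp Ω} {g g' : ℝ → EucSp d}

/-- The times at which neither of the two curves has exited. -/
def jointTimes (Ξ : Set (EucSp d)) (γ γ' : CurveSp Ω) : Set ℝ :=
  {t : ℝ | 0 < t ∧ ENNReal.ofReal t < min (exitT Ξ γ) (exitT Ξ γ')}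

theorem measurableSet_jointTimes : MeasurableSet (jointTimes Ξ γ γ') :=
  measurableSet_Ioi.inter (measurableSet_lt ENNReal.measurable_ofReal measurable_const)

theorem jointTimes_subset : jointTimes Ξ γ γ' ⊆ Ioi 0 := fun _ ht => ht.1

theorem setLIntegral_jointTimes (f : ℝ → ℝ≥0∞) :
    ∫⁻ t in jointTimes Ξ γ γ', f t =
      ∫⁻ t in Ioi (0 : ℝ), (jointTimes Ξ γ γ').indicator f t := by
  rw [lintegral_indicator measurableSet_jointTimes,
    Measure.restrict_restrict measurableSet_jointTimes, inter_eq_left.2 jointTimes_subset]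

theorem volume_jointTimes_le : volume (jointTimes Ξ γ γ') ≤ exitT Ξ γ := by
  rcases eq_or_ne (exitT Ξ γ) ⊤ with htop | htop
  · simp [htop]
  calc volume (jointTimes Ξ γ γ') ≤ volume (Ioc 0 (exitT Ξ γ).toReal) := by
        refine measure_mono fun t ht => ⟨ht.1, ?_⟩
        exact (ENNReal.ofReal_le_iff_le_toReal htop).1 (ht.2.le.trans (min_le_left _ _))
    _ = exitT Ξ γ := by rw [Real.volume_Ioc, sub_zero, ENNReal.ofReal_toReal htop]

theorem HasVel.interCost_eq (hg : HasVel γ g) (hg' : HasVel γ' g') :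
    interCost h Ξ γ γ' = ∫⁻ t in jointTimes Ξ γ γ',
      ENNReal.ofReal (h t (γ.1 t.toNNReal) (γ'.1 t.toNNReal) (g t) (g' t)) := by
  have hres : ∀ {p : ℝ → Prop}, (∀ᵐ t ∂volume.restrict (Ioi (0 : ℝ)), p t) →
      ∀ᵐ t ∂volume.restrict (jointTimes Ξ γ γ'), p t :=
    fun hp => ae_restrict_of_ae_restrict_of_subset jointTimes_subset hp
  refine (hg.iInf_eq fun u hu => ?_).trans (hg'.iInf_eq fun u hu => ?_)
  · refine iInf_congr fun v => iInf_congr fun _ => lintegral_congr_ae ?_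
    filter_upwards [hres hu] with t ht
    rw [ht]
  · refine lintegral_congr_ae ?_
    filter_upwards [hres hu] with t ht
    rw [ht]

theorem IsInteraction.interCost_comm (hh : IsInteraction Ω h C β) (γ γ' : CurveSp Ω) :
    interCost h Ξ γ γ' = interCost h Ξ γ' γ := by
  by_cases h1 : (∃ g, HasVel γ g) ∧ ∃ g', HasVel γ' g'
  · obtain ⟨⟨g, hg⟩, g', hg'⟩ := h1
    rw [hg.interCost_eq hg', hg'.interCost_eq hg]
    simp only [jointTimes, min_comm (exitT Ξ γ'), fun t => hh.symm t (γ'.1 t.toNNReal)]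
  · have h2 : ∀ γ₁ γ₂ : CurveSp Ω, (¬ ∃ g, HasVel γ₁ g) ∨ (¬ ∃ g, HasVel γ₂ g) →
        interCost h Ξ γ₁ γ₂ = ⊤ := by
      rintro γ₁ γ₂ (h3 | h3) <;> push Not at h3 <;> simp [interCost, h3]
    rw [h2 _ _ (not_and_or.1 h1), h2 _ _ (not_and_or.1 h1).symm]

theorem IsInteraction.aemeasurable (hh : IsInteraction Ω h C β) (hg : HasVel γ g)
    (hg' : HasVel γ' g') :
    AEMeasurable (fun t => h t (γ.1 t.toNNReal) (γ'.1 t.toNNReal) (g t) (g' t))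
      (volume.restrict (Ioi (0 : ℝ))) := by
  refine AEMeasurable.caratheodory_comp (Z := (closure Ω × closure Ω) × EucSp d × EucSp d)
    (F := fun t z => h t z.1.1 z.1.2 z.2.1 z.2.2)
    (z := fun t => ((curvePos γ t, curvePos γ' t), g t, g' t))
    (fun z => hh.measurable z.1.1 z.1.2 z.2.1 z.2.2) ?_
    (((continuous_curvePos γ).measurable.prodMk
      (continuous_curvePos γ').measurable).aemeasurable.prodMk
      (hg.aestronglyMeasurable.aemeasurable.prodMk hg'.aestronglyMeasurable.aemeasurable))
  filter_upwards [hh.ae_continuousOn] with t ht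
  exact ht.comp_continuous (f := fun z : (closure Ω × closure Ω) × EucSp d × EucSp d =>
    (((z.1.1 : EucSp d), (z.1.2 : EucSp d)), z.2))
    (by fun_prop) fun z => ⟨⟨z.1.1.2, z.1.2.2⟩, mem_univ _⟩

theorem convexOn_norm_rpow {V : Type*} [NormedAddCommGroup V] [NormedSpace ℝ V] {θ : ℝ}
    (hθ : 1 ≤ θ) : ConvexOn ℝ univ fun v : V => ‖v‖ ^ θ := by
  refine ⟨convex_univ, fun x _ y _ a b ha hb hab => ?_⟩
  calc ‖a • x + b • y‖ ^ θ ≤ (a • ‖x‖ + b • ‖y‖) ^ θ := by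
        refine Real.rpow_le_rpow (norm_nonneg _) ?_ (by linarith)
        exact convexOn_univ_norm.2 (mem_univ x) (mem_univ y) ha hb hab
    _ ≤ _ := (convexOn_rpow hθ).2 (norm_nonneg x) (norm_nonneg y) ha hb hab

theorem enorm_prodMk_rpow_le {V W : Type*} [NormedAddCommGroup V] [NormedAddCommGroup W]
    (θ : ℝ) (v : V) (w : W) : ‖(v, w)‖ₑ ^ θ ≤ ‖v‖ₑ ^ θ + ‖w‖ₑ ^ θ := by
  have : ‖(v, w)‖ₑ = max ‖v‖ₑ ‖w‖ₑ := by
    rw [← ofReal_norm, Prod.norm_def, ENNReal.ofReal_max, ofReal_norm, ofReal_norm]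
  rw [this]
  rcases le_total ‖v‖ₑ ‖w‖ₑ with h | h
  · rw [max_eq_right h]; exact le_add_self
  · rw [max_eq_left h]; exact le_self_add

variable {ℓ : ℝ → EucSp d → EucSp d → ℝ} {α θ : ℝ}

/-- Sequential lower semicontinuity of the interaction cost along curves of bounded cost. -/
theorem interCost_le_of_tendsto (hℓ : IsRunningCost Ω ℓ α θ) (hh : IsInteraction Ω h C β)
    (hΞ : IsClosed Ξ) {γ₁ γ₂ : ℕ → CurveSp Ω} {η₁ η₂ : CurveSp Ω}
    (h₁ : Tendsto γ₁ atTop (𝓝 η₁)) (h₂ : Tendsto γ₂ atTop (𝓝 η₂)) {r s : ℝ≥0}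
    (hr₁ : ∀ n, runCost ℓ (γ₁ n) ≤ r) (hr₂ : ∀ n, runCost ℓ (γ₂ n) ≤ r)
    (hs : ∀ n, interCost h Ξ (γ₁ n) (γ₂ n) ≤ s) : interCost h Ξ η₁ η₂ ≤ s := by
  have hθ0 : 0 ≤ θ := by linarith [hℓ.one_lt]
  choose g₁ hg₁ using fun n => exists_hasVel_of_runCost_ne_top
    (ne_top_of_le_ne_top ENNReal.coe_ne_top (hr₁ n))
  choose g₂ hg₂ using fun n => exists_hasVel_of_runCost_ne_top
    (ne_top_of_le_ne_top ENNReal.coe_ne_top (hr₂ n))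
  set M : ℝ≥0∞ := r / ENNReal.ofReal α + r / ENNReal.ofReal α
  have hM : M ≠ ⊤ := by
    have : (r : ℝ≥0∞) / ENNReal.ofReal α ≠ ⊤ :=
      ENNReal.div_ne_top ENNReal.coe_ne_top (by simpa using hℓ.pos)
    exact ENNReal.add_ne_top.2 ⟨this, this⟩
  have hgm : ∀ n, AEStronglyMeasurable (fun t => (g₁ n t, g₂ n t))
      (volume.restrict (Ioi (0 : ℝ))) := fun n =>
    (hg₁ n).aestronglyMeasurable.prodMk (hg₂ n).aestronglyMeasurable
  have hgM : ∀ n, ∫⁻ t in Ioi (0 : ℝ), ‖(g₁ n t, g₂ n t)‖ₑ ^ θ ≤ M := fun n =>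
    calc ∫⁻ t in Ioi (0 : ℝ), ‖(g₁ n t, g₂ n t)‖ₑ ^ θ
        ≤ ∫⁻ t in Ioi (0 : ℝ), (‖g₁ n t‖ₑ ^ θ + ‖g₂ n t‖ₑ ^ θ) :=
          lintegral_mono fun t => enorm_prodMk_rpow_le θ _ _
      _ = (∫⁻ t in Ioi (0 : ℝ), ‖g₁ n t‖ₑ ^ θ) + ∫⁻ t in Ioi (0 : ℝ), ‖g₂ n t‖ₑ ^ θ :=
          lintegral_add_left' ((hg₁ n).aestronglyMeasurable.enorm.pow_const θ) _
      _ ≤ M := add_le_add (hℓ.lintegral_le (hg₁ n) (hr₁ n)) (hℓ.lintegral_le (hg₂ n) (hr₂ n))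
  have key : ∀ ε : ℝ, 0 < ε → interCost h Ξ η₁ η₂ ≤ s + ENNReal.ofReal ε * M := by
    intro ε hε
    obtain ⟨g', hg'm, hg'θ, hg'η, hg'c⟩ := exists_velocity_lintegral_le_of_tendsto
      (X := closure Ω × closure Ω) (V := EucSp d × EucSp d)
      (f := fun t x p => h t x.1 x.2 p.1 p.2 + ε * ‖p‖ ^ θ)
      (x := fun n t => (curvePos (γ₁ n) t, curvePos (γ₂ n) t))
      (x' := fun t => (curvePos η₁ t, curvePos η₂ t))
      (g := fun n t => (g₁ n t, g₂ n t)) hε hℓ.one_lt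
      (by
        filter_upwards [hh.ae_continuousOn, hh.ae_convexOn, ae_restrict_mem measurableSet_Ioi]
          with t ht ht' htpos
        refine ⟨?_, fun x => ?_, fun x p => ?_⟩
        · refine (ht.comp_continuous
            (f := fun z : (closure Ω × closure Ω) × EucSp d × EucSp d =>
              (((z.1.1 : EucSp d), (z.1.2 : EucSp d)), z.2))
            (by fun_prop) fun z => ⟨⟨z.1.1.2, z.1.2.2⟩, mem_univ _⟩).add ?_
          exact continuous_const.mul
            ((continuous_norm.comp continuous_snd).rpow_const fun _ => Or.inr hθ0)
        · exact (ht' x.1 x.1.2 x.2 x.2.2).add ((convexOn_norm_rpow hℓ.one_lt.le).smul hε.le)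
        · have := hh.nonneg t (mem_Ici.2 (le_of_lt htpos)) x.1 x.1.2 x.2 x.2.2 p.1 p.2
          linarith)
      (fun t => (tendsto_curvePos h₁ t).prodMk_nhds (tendsto_curvePos h₂ t)) hgm hM hgM
      (η := fun n t => ((γ₁ n).1 t - (γ₁ n).1 0, (γ₂ n).1 t - (γ₂ n).1 0))
      (η' := fun t => (η₁.1 t - η₁.1 0, η₂.1 t - η₂.1 0))
      (fun t => (tendsto_curve_sub h₁ t).prodMk_nhds (tendsto_curve_sub h₂ t))
      (fun n t => by
        rw [integral_pair ((hg₁ n).integrableOn_Ioc 0 t le_rfl)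
          ((hg₂ n).integrableOn_Ioc 0 t le_rfl), (hg₁ n).2 t, (hg₂ n).2 t]
        simp)
      (E := fun n => jointTimes Ξ (γ₁ n) (γ₂ n)) (E' := jointTimes Ξ η₁ η₂)
      (fun t ht => by
        filter_upwards [h₁.eventually (lowerSemicontinuous_exitT hΞ η₁ _ (lt_min_iff.1 ht.2).1),
          h₂.eventually (lowerSemicontinuous_exitT hΞ η₂ _ (lt_min_iff.1 ht.2).2)] with n hn hn'
        exact ⟨ht.1, lt_min hn hn'⟩)
      (fun n => ((hh.aemeasurable (hg₁ n) (hg₂ n)).add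
        (((hgm n).norm.aemeasurable.pow_const θ).const_mul ε)).indicator measurableSet_jointTimes)
      (c := s + ENNReal.ofReal ε * M)
      (fun n => by
        calc _ ≤ ∫⁻ t in Ioi (0 : ℝ), ((jointTimes Ξ (γ₁ n) (γ₂ n)).indicator
                (fun t => ENNReal.ofReal
                  (h t ((γ₁ n).1 t.toNNReal) ((γ₂ n).1 t.toNNReal) (g₁ n t) (g₂ n t))) t +
                ENNReal.ofReal ε * ‖(g₁ n t, g₂ n t)‖ₑ ^ θ) := by
              refine lintegral_mono fun t => ?_
              by_cases ht : t ∈ jointTimes Ξ (γ₁ n) (γ₂ n)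
              · simp only [indicator_of_mem ht]
                refine ENNReal.ofReal_add_le.trans (add_le_add le_rfl ?_)
                rw [ENNReal.ofReal_mul hε.le, ← ofReal_norm,
                  ENNReal.ofReal_rpow_of_nonneg (norm_nonneg _) hθ0]
              · simp [indicator_of_notMem ht]
          _ = interCost h Ξ (γ₁ n) (γ₂ n) +
                ENNReal.ofReal ε * ∫⁻ t in Ioi (0 : ℝ), ‖(g₁ n t, g₂ n t)‖ₑ ^ θ := by
              rw [lintegral_add_right' _ (((hgm n).enorm.pow_const θ).const_mul _),
                lintegral_const_mul' _ _ ENNReal.ofReal_ne_top,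
                ← setLIntegral_jointTimes, (hg₁ n).interCost_eq (hg₂ n)]
          _ ≤ _ := by gcongr; exacts [hs n, hgM n])
    have hcomp : ∀ t : ℝ≥0, η₁.1 t - η₁.1 0 = ∫ s in Ioc (0 : ℝ) t, (g' s).1 ∧
        η₂.1 t - η₂.1 0 = ∫ s in Ioc (0 : ℝ) t, (g' s).2 := by
      intro t
      have hint : IntegrableOn g' (Ioc (0 : ℝ) t) :=
        integrable_of_lintegral_enorm_rpow hℓ.one_lt (hg'm.mono_set Ioc_subset_Ioi_self)
          (ne_top_of_le_ne_top hM ((lintegral_mono_set Ioc_subset_Ioi_self).trans hg'θ))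
      have := hg'η t
      rw [Prod.ext_iff, fst_integral hint, snd_integral hint] at this
      exact this
    have hle₁ : ∫⁻ t in Ioi (0 : ℝ), ‖(g' t).1‖ₑ ^ θ ≠ ⊤ := by
      refine ne_top_of_le_ne_top hM (le_trans (lintegral_mono fun t => ?_) hg'θ)
      exact ENNReal.rpow_le_rpow (enorm_le_iff_norm_le.2 (norm_fst_le _)) hθ0
    have hle₂ : ∫⁻ t in Ioi (0 : ℝ), ‖(g' t).2‖ₑ ^ θ ≠ ⊤ := by
      refine ne_top_of_le_ne_top hM (le_trans (lintegral_mono fun t => ?_) hg'θ)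
      exact ENNReal.rpow_le_rpow (enorm_le_iff_norm_le.2 (norm_snd_le _)) hθ0
    have hv₁ := hasVel_of_lintegral_enorm_rpow_ne_top hℓ.one_lt hg'm.fst hle₁
      fun t => (hcomp t).1
    have hv₂ := hasVel_of_lintegral_enorm_rpow_ne_top hℓ.one_lt hg'm.snd hle₂
      fun t => (hcomp t).2
    rw [hv₁.interCost_eq hv₂]
    refine le_trans ?_ hg'c
    rw [setLIntegral_jointTimes]
    refine lintegral_mono fun t => ?_
    by_cases ht : t ∈ jointTimes Ξ η₁ η₂
    · simp only [indicator_of_mem ht]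
      exact ENNReal.ofReal_le_ofReal (le_add_of_nonneg_right (by positivity))
    · simp [indicator_of_notMem ht]
  have hlim : Tendsto (fun ε : ℝ => (s : ℝ≥0∞) + ENNReal.ofReal ε * M) (𝓝[>] 0)
      (𝓝 (s + ENNReal.ofReal 0 * M)) :=
    ((ENNReal.Tendsto.mul_const (ENNReal.tendsto_ofReal tendsto_id) (Or.inr hM)).const_add
      _).mono_left nhdsWithin_le_nhds
  rw [ENNReal.ofReal_zero, zero_mul, add_zero] at hlim
  exact ge_of_tendsto hlim (eventually_mem_nhdsWithin.mono fun ε hε => key ε hε)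

end Interaction

section EffectiveInteraction

theorem lowerSemicontinuous_add_of_isClosed {X : Type*} [TopologicalSpace X] {L J : X → ℝ≥0∞}
    (hL : LowerSemicontinuous L) (hJ : ∀ r s : ℝ≥0, IsClosed {x | L x ≤ r ∧ J x ≤ s}) :
    LowerSemicontinuous fun x => L x + J x := by
  classical
  rw [lowerSemicontinuous_iff_isClosed_preimage]
  intro y
  induction y with
  | top => simp
  | coe r =>
    have hJr : LowerSemicontinuous fun x => if L x ≤ r then J x else ⊤ := by
      rw [lowerSemicontinuous_iff_isClosed_preimage]
      intro y
      induction y with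
      | top => simp
      | coe s =>
        convert hJ r s using 1
        ext x
        by_cases hx : L x ≤ r <;> simp [hx]
    convert (hL.add hJr).isClosed_preimage r using 1
    ext x
    by_cases hx : L x ≤ r
    · simp [hx]
    · simpa [hx] using fun h => hx (le_self_add.trans h)

theorem measurable_of_add {X : Type*} [MeasurableSpace X] {L J : X → ℝ≥0∞} (hL : Measurable L)
    (h : Measurable fun x => L x + J x) (h0 : ∀ x, L x = ⊤ → J x = 0) : Measurable J := by
  have : J = {x | L x = ⊤}ᶜ.indicator fun x => L x + J x - L x := by
    ext x
    by_cases hx : L x = ⊤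
    · rw [h0 x hx, indicator_of_notMem (fun hn : x ∈ {x | L x = ⊤}ᶜ => hn hx)]
    · rw [indicator_of_mem (show x ∈ {x | L x = ⊤}ᶜ from hx), ENNReal.add_sub_cancel_left hx]
  rw [this]
  exact (h.sub hL).indicator (hL (measurableSet_singleton ⊤)).compl

variable {Ω Ξ : Set (EucSp d)} {h : ℝ → EucSp d → EucSp d → EucSp d → EucSp d → ℝ} {C β : ℝ}
  {ℓ : ℝ → EucSp d → EucSp d → ℝ} {α θ : ℝ} {Ψ : ℝ → ℝ} {γ γ' : CurveSp Ω}

theorem runCost_le_Lcost : runCost ℓ γ ≤ Lcost ℓ Ψ Ξ γ := le_self_add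

theorem PsiExt_le_Lcost : PsiExt Ψ (exitT Ξ γ) ≤ Lcost ℓ Ψ Ξ γ := le_add_self

theorem IsRunningCost.lowerSemicontinuous_Lcost (hℓ : IsRunningCost Ω ℓ α θ)
    (hΨ : LowerSemicontinuousOn Ψ (Ici 0)) (hΞ : IsClosed Ξ) :
    LowerSemicontinuous (Lcost ℓ Ψ Ξ : CurveSp Ω → ℝ≥0∞) :=
  hℓ.lowerSemicontinuous_runCost.add (lowerSemicontinuous_PsiExt_exitT hΨ hΞ)

open Classical in
/-- The interaction cost, set to zero when one of the curves has infinite individual cost. -/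
def effInter (ℓ : ℝ → EucSp d → EucSp d → ℝ) (Ψ : ℝ → ℝ)
    (h : ℝ → EucSp d → EucSp d → EucSp d → EucSp d → ℝ) (Ξ : Set (EucSp d))
    (γ γ' : CurveSp Ω) : ℝ≥0∞ :=
  if Lcost ℓ Ψ Ξ γ + Lcost ℓ Ψ Ξ γ' = ⊤ then 0 else interCost h Ξ γ γ'

theorem effInter_eq_interCost (hγ : Lcost ℓ Ψ Ξ γ ≠ ⊤) (hγ' : Lcost ℓ Ψ Ξ γ' ≠ ⊤) :
    effInter ℓ Ψ h Ξ γ γ' = interCost h Ξ γ γ' :=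
  if_neg (ENNReal.add_ne_top.2 ⟨hγ, hγ'⟩)

theorem IsInteraction.effInter_comm (hh : IsInteraction Ω h C β) (γ γ' : CurveSp Ω) :
    effInter ℓ Ψ h Ξ γ γ' = effInter ℓ Ψ h Ξ γ' γ := by
  rw [effInter, effInter, add_comm, hh.interCost_comm]

theorem lowerSemicontinuous_Lcost_add_effInter (hℓ : IsRunningCost Ω ℓ α θ)
    (hh : IsInteraction Ω h C β) (hΨ : LowerSemicontinuousOn Ψ (Ici 0)) (hΞ : IsClosed Ξ) :
    LowerSemicontinuous fun p : CurveSp Ω × CurveSp Ω =>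
      Lcost ℓ Ψ Ξ p.1 + Lcost ℓ Ψ Ξ p.2 + effInter ℓ Ψ h Ξ p.1 p.2 := by
  have hL := hℓ.lowerSemicontinuous_Lcost hΨ hΞ
  have hL2 : LowerSemicontinuous fun p : CurveSp Ω × CurveSp Ω =>
      Lcost ℓ Ψ Ξ p.1 + Lcost ℓ Ψ Ξ p.2 :=
    (hL.comp continuous_fst).add (hL.comp continuous_snd)
  refine lowerSemicontinuous_add_of_isClosed hL2 fun r s => IsSeqClosed.isClosed fun p q hp hq => ?_
  have hq1 : Lcost ℓ Ψ Ξ q.1 + Lcost ℓ Ψ Ξ q.2 ≤ r :=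
    (hL2.isClosed_preimage r).mem_of_tendsto hq (Eventually.of_forall fun n => (hp n).1)
  refine ⟨hq1, ?_⟩
  rw [effInter, if_neg (ne_top_of_le_ne_top ENNReal.coe_ne_top hq1)]
  refine interCost_le_of_tendsto (r := r) hℓ hh hΞ (continuous_fst.tendsto q |>.comp hq)
    (continuous_snd.tendsto q |>.comp hq)
    (fun n => runCost_le_Lcost.trans (le_self_add.trans (hp n).1))
    (fun n => runCost_le_Lcost.trans (le_add_self.trans (hp n).1)) fun n => ?_
  have := (hp n).2
  rwa [effInter, if_neg (ne_top_of_le_ne_top ENNReal.coe_ne_top (hp n).1)] at this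

theorem measurable_effInter (hℓ : IsRunningCost Ω ℓ α θ)
    (hh : IsInteraction Ω h C β) (hΨ : LowerSemicontinuousOn Ψ (Ici 0)) (hΞ : IsClosed Ξ) :
    Measurable (Function.uncurry (effInter ℓ Ψ h Ξ : CurveSp Ω → CurveSp Ω → ℝ≥0∞)) := by
  have hL := (hℓ.lowerSemicontinuous_Lcost hΨ hΞ).measurable
  exact measurable_of_add ((hL.comp measurable_fst).add (hL.comp measurable_snd))
    (lowerSemicontinuous_Lcost_add_effInter hℓ hh hΨ hΞ).measurable fun p hp => if_pos hp

theorem exists_effInter_le (hℓ : IsRunningCost Ω ℓ α θ) (hh : IsInteraction Ω h C β)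
    (hβθ : β ≤ θ) {a b : ℝ} (ha : 0 < a) (hΨ : ∀ t ∈ Ici (0 : ℝ), a * t - b ≤ Ψ t) :
    ∃ A B : ℝ≥0, ∀ γ γ' : CurveSp Ω,
      effInter ℓ Ψ h Ξ γ γ' ≤ A + B * (Lcost ℓ Ψ Ξ γ + Lcost ℓ Ψ Ξ γ') := by
  have hθ0 : 0 ≤ θ := by linarith [hℓ.one_lt]
  set a' := (ENNReal.ofReal a)⁻¹
  set b' := ENNReal.ofReal b
  set c' := ENNReal.ofReal C
  set α' := (ENNReal.ofReal α)⁻¹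
  have hatop : a' ≠ ⊤ := ENNReal.inv_ne_top.2 (by simpa using ha)
  have hαtop : α' ≠ ⊤ := ENNReal.inv_ne_top.2 (by simpa using hℓ.pos)
  refine ⟨(c' * (2 * (b' * a'))).toNNReal, (c' * (2 * a' + α')).toNNReal, fun γ γ' => ?_⟩
  rw [ENNReal.coe_toNNReal (by finiteness), ENNReal.coe_toNNReal (by finiteness)]
  by_cases hne : Lcost ℓ Ψ Ξ γ + Lcost ℓ Ψ Ξ γ' = ⊤
  · rw [effInter, if_pos hne]
    exact zero_le
  rw [effInter, if_neg hne]
  rw [← ne_eq, ENNReal.add_ne_top] at hne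
  obtain ⟨g, hg⟩ := exists_hasVel_of_runCost_ne_top
    (ne_top_of_le_ne_top hne.1 (runCost_le_Lcost (ℓ := ℓ) (γ := γ)))
  obtain ⟨g', hg'⟩ := exists_hasVel_of_runCost_ne_top
    (ne_top_of_le_ne_top hne.2 (runCost_le_Lcost (ℓ := ℓ) (γ := γ')))
  have hpt : ∀ p : EucSp d, ENNReal.ofReal (‖p‖ ^ β) ≤ 1 + ‖p‖ₑ ^ θ := by
    intro p
    refine (ENNReal.ofReal_le_ofReal (rpow_le_one_add_rpow (norm_nonneg p) hh.exponent_pos.le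
      hβθ)).trans ?_
    rw [ENNReal.ofReal_add zero_le_one (by positivity), ENNReal.ofReal_one, ← ofReal_norm,
      ENNReal.ofReal_rpow_of_nonneg (norm_nonneg _) hθ0]
  have hτ : volume (jointTimes Ξ γ γ') ≤ (Lcost ℓ Ψ Ξ γ + b') * a' :=
    volume_jointTimes_le.trans ((le_of_affine_le_PsiExt ha hΨ _).trans (by
      rw [div_eq_mul_inv]
      gcongr
      exact PsiExt_le_Lcost))
  have hI : ∀ {η : CurveSp Ω} {u : ℝ → EucSp d}, HasVel η u →
      ∫⁻ t in jointTimes Ξ γ γ', ‖u t‖ₑ ^ θ ≤ Lcost ℓ Ψ Ξ η * α' := fun hu =>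
    (lintegral_mono_set jointTimes_subset).trans (hℓ.lintegral_le hu runCost_le_Lcost)
  have hm : ∀ {η : CurveSp Ω} {u : ℝ → EucSp d}, HasVel η u →
      AEMeasurable (fun t => ‖u t‖ₑ ^ θ) (volume.restrict (jointTimes Ξ γ γ')) := fun hu =>
    ((hu.aestronglyMeasurable.mono_set jointTimes_subset).enorm.pow_const θ)
  calc interCost h Ξ γ γ'
      ≤ ∫⁻ t in jointTimes Ξ γ γ', c' * (2 + (‖g t‖ₑ ^ θ + ‖g' t‖ₑ ^ θ)) := by
        rw [hg.interCost_eq hg']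
        refine setLIntegral_mono_ae' measurableSet_jointTimes (ae_of_all _ fun t ht => ?_)
        refine (ENNReal.ofReal_le_ofReal
          (hh.le t (mem_Ici.2 ht.1.le) _ (γ.2 _) _ (γ'.2 _) _ _)).trans ?_
        rw [ENNReal.ofReal_mul hh.const_pos.le, ENNReal.ofReal_add (by positivity) (by positivity)]
        refine mul_le_mul' le_rfl ((add_le_add (hpt _) (hpt _)).trans_eq ?_)
        rw [add_add_add_comm, one_add_one_eq_two]
    _ = c' * (2 * volume (jointTimes Ξ γ γ') + ((∫⁻ t in jointTimes Ξ γ γ', ‖g t‖ₑ ^ θ) +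
          ∫⁻ t in jointTimes Ξ γ γ', ‖g' t‖ₑ ^ θ)) := by
        rw [lintegral_const_mul' _ _ ENNReal.ofReal_ne_top,
          lintegral_add_left' aemeasurable_const, setLIntegral_const,
          lintegral_add_left' (hm hg)]
    _ ≤ c' * (2 * ((Lcost ℓ Ψ Ξ γ + b') * a') +
          (Lcost ℓ Ψ Ξ γ * α' + Lcost ℓ Ψ Ξ γ' * α')) := by
        gcongr
        exacts [hI hg, hI hg']
    _ ≤ c' * (2 * ((Lcost ℓ Ψ Ξ γ + b') * a') +
          (Lcost ℓ Ψ Ξ γ * α' + Lcost ℓ Ψ Ξ γ' * α')) + c' * (2 * a') * Lcost ℓ Ψ Ξ γ' :=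
        le_self_add
    _ = _ := by ring

end EffectiveInteraction

section Compactness

/-- Curves in a compact set with a common modulus of continuity form a compact family. -/
theorem isCompact_setOf_dist_le {X E : Type*} [PseudoMetricSpace X] [MetricSpace E] {S : Set E}
    (hS : IsCompact S) (R : ℕ → ℝ≥0) {δ : ℕ → ℝ} (hδ : Tendsto δ atTop (𝓝 0)) :
    IsCompact {γ : C(X, E) | (∀ t, γ t ∈ S) ∧
      ∀ k s t, dist (γ s) (γ t) ≤ R k * dist s t + δ k} := by
  have hmod : ∀ ε : ℝ, 0 < ε → ∃ η > 0, ∀ f : X → E,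
      (∀ k s t, dist (f s) (f t) ≤ R k * dist s t + δ k) →
      ∀ s t, dist s t < η → dist (f s) (f t) < ε := by
    intro ε hε
    obtain ⟨k, hk⟩ := (hδ.eventually_lt_const (half_pos hε)).exists
    refine ⟨ε / 2 / (R k + 1), by positivity, fun f hf s t hst => ?_⟩
    have h1 : dist s t * (R k + 1) < ε / 2 := (lt_div_iff₀ (by positivity)).1 hst
    have h2 := hf k s t
    have h3 : (0 : ℝ) ≤ dist s t := dist_nonneg
    nlinarith
  refine ArzelaAscoli.isCompact_of_equicontinuous _ ?_ ?_
  · have himage : ContinuousMap.toFun '' {γ : C(X, E) | (∀ t, γ t ∈ S) ∧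
        ∀ k s t, dist (γ s) (γ t) ≤ R k * dist s t + δ k} =
        (Set.pi univ fun _ => S) ∩ {f : X → E | ∀ k s t,
          dist (f s) (f t) ≤ R k * dist s t + δ k} := by
      ext f
      constructor
      · rintro ⟨γ, hγ, rfl⟩
        exact ⟨fun t _ => hγ.1 t, hγ.2⟩
      · rintro ⟨hf, hf'⟩
        refine ⟨⟨f, Metric.continuous_iff.2 fun t ε hε => ?_⟩,
          ⟨fun t => hf t (mem_univ t), hf'⟩, rfl⟩
        obtain ⟨η, hη, h⟩ := hmod ε hε
        exact ⟨η, hη, fun s hs => h f hf' s t hs⟩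
    rw [himage]
    refine (isCompact_univ_pi fun _ => hS).inter_right ?_
    simp only [ofPred_forall]
    exact isClosed_iInter fun k => isClosed_iInter fun s => isClosed_iInter fun t =>
      isClosed_le ((continuous_apply s).dist (continuous_apply t)) continuous_const
  · intro x
    rw [Metric.equicontinuousAt_iff]
    intro ε hε
    obtain ⟨η, hη, h⟩ := hmod ε hε
    exact ⟨η, hη, fun s hs γ => h γ.1 γ.2.2 x s (by rwa [dist_comm])⟩

variable {Ω Ξ : Set (EucSp d)} {ℓ : ℝ → EucSp d → EucSp d → ℝ} {α θ : ℝ} {Ψ : ℝ → ℝ}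

theorem IsRunningCost.dist_le (hℓ : IsRunningCost Ω ℓ α θ) {γ : CurveSp Ω} {c : ℝ≥0}
    (hc : runCost ℓ γ ≤ c) {R : ℝ≥0} {k : ℕ}
    (hR : ∀ s : ℝ, R ≤ s → ((k : ℝ) + 1) * s ≤ s ^ θ) (s t : ℝ≥0) :
    dist (γ.1 s) (γ.1 t) ≤ R * dist s t + c / α * (1 / ((k : ℝ) + 1)) := by
  have hθ0 : 0 ≤ θ := by linarith [hℓ.one_lt]
  have hα := hℓ.pos
  have hk : (0 : ℝ) < (k : ℝ) + 1 := by positivity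
  wlog hst : s ≤ t generalizing s t
  · rw [dist_comm, dist_comm s]
    exact this t s (le_of_not_ge hst)
  obtain ⟨g, hg⟩ := exists_hasVel_of_runCost_ne_top (ne_top_of_le_ne_top ENNReal.coe_ne_top hc)
  have hpt : ∀ p : EucSp d,
      ‖p‖ₑ ≤ ENNReal.ofReal R + ENNReal.ofReal (1 / ((k : ℝ) + 1)) * ‖p‖ₑ ^ θ := by
    intro p
    rw [← ofReal_norm, ENNReal.ofReal_rpow_of_nonneg (norm_nonneg _) hθ0,
      ← ENNReal.ofReal_mul (by positivity), ← ENNReal.ofReal_add R.coe_nonneg (by positivity)]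
    refine ENNReal.ofReal_le_ofReal ?_
    rcases le_total (‖p‖) R with h | h
    · exact h.trans (le_add_of_nonneg_right (by positivity))
    · refine le_trans ?_ (le_add_of_nonneg_left R.coe_nonneg)
      rw [one_div, ← div_eq_inv_mul, le_div_iff₀ hk, mul_comm]
      exact hR _ h
  have hsub : Ioc (s : ℝ) t ⊆ Ioi 0 := fun x hx => s.coe_nonneg.trans_lt hx.1
  rw [dist_comm, dist_comm s, dist_eq_norm, hg.sub_eq hst, NNReal.dist_eq,
    abs_of_nonneg (sub_nonneg.2 (NNReal.coe_le_coe.2 hst))]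
  have hst' : (0 : ℝ) ≤ t - s := sub_nonneg.2 (NNReal.coe_le_coe.2 hst)
  rw [← ENNReal.ofReal_le_ofReal_iff (by positivity), ofReal_norm]
  calc ‖∫ r in Ioc (s : ℝ) t, g r‖ₑ ≤ ∫⁻ r in Ioc (s : ℝ) t, ‖g r‖ₑ :=
        enorm_integral_le_lintegral_enorm _
    _ ≤ ∫⁻ r in Ioc (s : ℝ) t,
          (ENNReal.ofReal R + ENNReal.ofReal (1 / ((k : ℝ) + 1)) * ‖g r‖ₑ ^ θ) :=
        lintegral_mono fun r => hpt _
    _ = ENNReal.ofReal R * ENNReal.ofReal (t - s) +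
          ENNReal.ofReal (1 / ((k : ℝ) + 1)) * ∫⁻ r in Ioc (s : ℝ) t, ‖g r‖ₑ ^ θ := by
        rw [lintegral_add_left' aemeasurable_const, setLIntegral_const, Real.volume_Ioc,
          lintegral_const_mul' _ _ ENNReal.ofReal_ne_top]
    _ ≤ ENNReal.ofReal R * ENNReal.ofReal (t - s) +
          ENNReal.ofReal (1 / ((k : ℝ) + 1)) * (c / ENNReal.ofReal α) := by
        gcongr
        exact (lintegral_mono_set hsub).trans (hℓ.lintegral_le hg hc)
    _ = ENNReal.ofReal (R * (t - s) + c / α * (1 / ((k : ℝ) + 1))) := by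
        rw [ENNReal.ofReal_add (by positivity) (by positivity), ENNReal.ofReal_mul R.coe_nonneg,
          ENNReal.ofReal_mul (by positivity), ENNReal.ofReal_div_of_pos hα,
          ENNReal.ofReal_coe_nnreal (p := c), mul_comm (c / ENNReal.ofReal α : ℝ≥0∞)]

theorem IsRunningCost.isCompact_Lcost_le (hℓ : IsRunningCost Ω ℓ α θ)
    (hΩ : Bornology.IsBounded Ω) (hΨ : LowerSemicontinuousOn Ψ (Ici 0)) (hΞ : IsClosed Ξ)
    (c : ℝ≥0) : IsCompact {γ : CurveSp Ω | Lcost ℓ Ψ Ξ γ ≤ c} := by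
  choose R hR using fun k : ℕ => exists_forall_mul_le_rpow hℓ.one_lt ((k : ℝ) + 1)
  have hδ : Tendsto (fun k : ℕ => (c : ℝ) / α * (1 / ((k : ℝ) + 1))) atTop (𝓝 0) := by
    simpa using tendsto_one_div_add_atTop_nhds_zero_nat.const_mul ((c : ℝ) / α)
  have hcomp := isCompact_setOf_dist_le (X := ℝ≥0) hΩ.isCompact_closure R hδ
  have hpre : IsCompact ((Subtype.val : CurveSp Ω → C(ℝ≥0, EucSp d)) ⁻¹'
      {γ : C(ℝ≥0, EucSp d) | (∀ t, γ t ∈ closure Ω) ∧ ∀ k s t,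
        dist (γ s) (γ t) ≤ R k * dist s t + c / α * (1 / ((k : ℝ) + 1))}) := by
    refine IsEmbedding.subtypeVal.isCompact_iff.2 ?_
    rwa [image_preimage_eq_of_subset fun γ hγ => ⟨⟨γ, hγ.1⟩, rfl⟩]
  refine hpre.of_isClosed_subset ((hℓ.lowerSemicontinuous_Lcost hΨ hΞ).isClosed_preimage c)
    fun γ hγ => ⟨γ.2, fun k s t => ?_⟩
  exact hℓ.dist_le (runCost_le_Lcost.trans hγ) (hR k).2 s t

end Compactness

section Equilibrium

variable {Ω Ξ : Set (EucSp d)} {h : ℝ → EucSp d → EucSp d → EucSp d → EucSp d → ℝ}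
  {ℓ : ℝ → EucSp d → EucSp d → ℝ} {Ψ : ℝ → ℝ}

theorem F1cost_eq_Lcost_add_lintegral_effInter {Q : Measure (CurveSp Ω)}
    (hQ : ∀ᵐ γ ∂Q, Lcost ℓ Ψ Ξ γ ≠ ⊤) (γ : CurveSp Ω) :
    F1cost ℓ Ψ h Ξ γ Q = Lcost ℓ Ψ Ξ γ + ∫⁻ γ', effInter ℓ Ψ h Ξ γ γ' ∂Q := by
  have hnull : Q {γ' : CurveSp Ω | ¬ ∃ g : ℝ → EucSp d, HasVel γ' g} = 0 := by
    refine ae_iff.1 (hQ.mono fun γ' hγ' => exists_hasVel_of_runCost_ne_top (ℓ := ℓ) ?_)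
    exact ne_top_of_le_ne_top hγ' runCost_le_Lcost
  rw [F1cost, if_pos hnull]
  by_cases hγ : Lcost ℓ Ψ Ξ γ = ⊤
  · rw [hγ, top_add, top_add]
  · congr 1
    refine lintegral_congr_ae (hQ.mono fun γ' hγ' => ?_)
    exact (effInter_eq_interCost hγ hγ').symm

theorem map_comap_subtype_val_of_measure_eq_one {E : Type*} [MeasurableSpace E] {S : Set E}
    (hS : MeasurableSet S) (m : Measure E) [IsProbabilityMeasure m] (hm : m S = 1) :
    (m.comap (Subtype.val : S → E)).map Subtype.val = m := by
  rw [map_comap_subtype_coe hS]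
  exact Measure.restrict_eq_self_of_ae_mem ((prob_compl_eq_zero_iff hS).2 hm)

end Equilibrium

/-- Theorem `thm:3:exist`: under (H1)–(H6), for every `m₀ ∈ 𝓟(Ω̄)` there exists an equilibrium `Q ∈ 𝓟(Γ)` of the mean field game with initial condition `m₀`. -/
theorem exists_equilibrium_MFG {d : ℕ}
    (Ω : Set (EucSp d)) (hΩne : Ω.Nonempty) (hΩop : IsOpen Ω)
    (hΩbd : Bornology.IsBounded Ω)
    (Ξ : Set (EucSp d)) (hΞne : Ξ.Nonempty) (hΞcl : IsClosed Ξ) (hΞsub : Ξ ⊆ closure Ω)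
    (ℓ : ℝ → EucSp d → EucSp d → ℝ)
    (hℓmeas : ∀ x p, Measurable fun t : ℝ => ℓ t x p)
    (hℓcont : ∀ᵐ t ∂(volume.restrict (Set.Ioi (0 : ℝ))),
      ContinuousOn (fun q : EucSp d × EucSp d => ℓ t q.1 q.2)
        ((closure Ω) ×ˢ (Set.univ : Set (EucSp d))))
    (hℓconv : ∀ᵐ t ∂(volume.restrict (Set.Ioi (0 : ℝ))), ∀ x ∈ closure Ω,
      ConvexOn ℝ Set.univ fun p => ℓ t x p)
    (hℓnn : ∀ t ∈ Set.Ici (0 : ℝ), ∀ x ∈ closure Ω, ∀ p, 0 ≤ ℓ t x p)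
    (α θ : ℝ) (hα : 0 < α) (hθ : 1 < θ)
    (hℓlb : ∀ t ∈ Set.Ici (0 : ℝ), ∀ x ∈ closure Ω, ∀ p, α * ‖p‖ ^ θ ≤ ℓ t x p)
    (h : ℝ → EucSp d → EucSp d → EucSp d → EucSp d → ℝ)
    (hhmeas : ∀ x x' p p', Measurable fun t : ℝ => h t x x' p p')
    (hhcont : ∀ᵐ t ∂(volume.restrict (Set.Ioi (0 : ℝ))),
      ContinuousOn
        (fun q : (EucSp d × EucSp d) × EucSp d × EucSp d => h t q.1.1 q.1.2 q.2.1 q.2.2)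
        (((closure Ω) ×ˢ (closure Ω)) ×ˢ (Set.univ : Set (EucSp d × EucSp d))))
    (hhconv : ∀ᵐ t ∂(volume.restrict (Set.Ioi (0 : ℝ))), ∀ x ∈ closure Ω, ∀ x' ∈ closure Ω,
      ConvexOn ℝ Set.univ fun q : EucSp d × EucSp d => h t x x' q.1 q.2)
    (hhsymm : ∀ t x x' p p', h t x x' p p' = h t x' x p' p)
    (hhnn : ∀ t ∈ Set.Ici (0 : ℝ), ∀ x ∈ closure Ω, ∀ x' ∈ closure Ω, ∀ p p',
      0 ≤ h t x x' p p')
    (C β : ℝ) (hC : 0 < C) (hβ : 0 < β) (hβθ : β ≤ θ)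
    (hhub : ∀ t ∈ Set.Ici (0 : ℝ), ∀ x ∈ closure Ω, ∀ x' ∈ closure Ω, ∀ p p',
      h t x x' p p' ≤ C * (‖p‖ ^ β + ‖p'‖ ^ β))
    (Ψ : ℝ → ℝ) (hΨnn : ∀ t ∈ Set.Ici (0 : ℝ), 0 ≤ Ψ t)
    (hΨlsc : LowerSemicontinuousOn Ψ (Set.Ici 0)) (hΨmono : MonotoneOn Ψ (Set.Ici 0))
    (a b : ℝ) (ha : 0 < a) (hb : 0 < b)
    (hΨlb : ∀ t ∈ Set.Ici (0 : ℝ), a * t - b ≤ Ψ t)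
    (κ : ℝ) (hκ : 0 < κ)
    (hH6 : ∀ x₀ ∈ closure Ω, ∃ γ : CurveSp Ω, γ.1 0 = x₀ ∧ Lcost ℓ Ψ Ξ γ ≤ ENNReal.ofReal κ)
    (m₀ : Measure (EucSp d)) (hm₀ : IsProbabilityMeasure m₀) (hm₀supp : m₀ (closure Ω) = 1) :
    ∃ Q : Measure (CurveSp Ω), IsProbabilityMeasure Q ∧
      Q.map (fun γ : CurveSp Ω => γ.1 0) = m₀ ∧
      (∫⁻ γ, F1cost ℓ Ψ h Ξ γ Q ∂Q) ≠ ⊤ ∧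
      ∀ᵐ γ ∂Q, F1cost ℓ Ψ h Ξ γ Q =
        ⨅ (ω : CurveSp Ω) (_ : ω.1 0 = γ.1 0), F1cost ℓ Ψ h Ξ ω Q := by
  have hℓ : IsRunningCost Ω ℓ α θ := ⟨hα, hθ, hℓmeas, hℓcont, hℓconv, hℓlb⟩
  have hh : IsInteraction Ω h C β := ⟨hC, hβ, hhmeas, hhcont, hhconv, hhsymm, hhnn, hhub⟩
  have hL := (hℓ.lowerSemicontinuous_Lcost hΨlsc hΞcl).measurable
  have hSm : MeasurableSet (closure Ω) := isClosed_closure.measurableSet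
  have hmap := map_comap_subtype_val_of_measure_eq_one hSm m₀ hm₀supp
  let e : CurveSp Ω → closure Ω := fun γ => ⟨γ.1 0, γ.2 0⟩
  have he : Continuous e :=
    ((continuous_eval_const (0 : ℝ≥0)).comp continuous_subtype_val).subtype_mk _
  have hm : IsProbabilityMeasure (m₀.comap (Subtype.val : closure Ω → EucSp d)) :=
    (MeasurableEmbedding.subtype_coe hSm).isProbabilityMeasure_comap
      (by rw [Subtype.range_coe]; exact (prob_compl_eq_zero_iff hSm).2 hm₀supp)
  obtain ⟨A, B, hAB⟩ := exists_effInter_le (Ξ := Ξ) hℓ hh hβθ ha hΨlb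
  obtain ⟨Q, hQm, hQL, hQI, hQeq⟩ := exists_symmetric_game_equilibrium he
    ⟨m₀.comap (Subtype.val : closure Ω → EucSp d), hm⟩
    (hℓ.isCompact_Lcost_le hΩbd hΨlsc hΞcl) (measurable_effInter hℓ hh hΨlsc hΞcl)
    hh.effInter_comm (lowerSemicontinuous_Lcost_add_effInter hℓ hh hΨlsc hΞcl) hAB
    (κ := κ.toNNReal) fun y => by
      obtain ⟨γ, hγ, hγκ⟩ := hH6 y y.2
      exact ⟨γ, Subtype.ext hγ, hγκ⟩
  have hfin : ∀ᵐ γ ∂(Q : Measure (CurveSp Ω)), Lcost ℓ Ψ Ξ γ ≠ ⊤ :=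
    (ae_lt_top hL hQL).mono fun γ hγ => hγ.ne
  have hF := F1cost_eq_Lcost_add_lintegral_effInter (h := h) hfin
  refine ⟨Q, inferInstance, ?_, ?_, ?_⟩
  · rw [← hmap, ← show (Q : Measure (CurveSp Ω)).map e = m₀.comap Subtype.val from hQm,
      Measure.map_map measurable_subtype_coe he.measurable]
    rfl
  · simpa only [hF] using hQI
  · filter_upwards [hQeq] with γ hγ
    simp only [hF]
    rw [hγ]
    simp only [e, Subtype.ext_iff]

end
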